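/- Extend R_β⁽ⁿ⁾(·,k,y) to all of ℝ by setting R_β⁽ⁿ⁾(s,k,y) := 0 for s < 0. For every real κ ≥ 1 there exist a constant C > 0 and an integer n₀ ≥ 1 such that for every n ≥ n₀, every δ ≥ 0, every integer k ≥ 1 and every y = (y₁,…,y_k) ∈ [0,∞)^k, ∫_ℝ |R_β⁽ⁿ⁾(γₙ(t+δ), k, y) − R_β⁽ⁿ⁾(γₙ t, k, y)|^{2κ} dt ≤ C (Σ_{j=1}^k (1 + y_j))^{2κ} (δ + δ²). -/

import Mathlib

open MeasureTheory Filter Set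

noncomputable def convIter (f : ℝ → ℝ) : ℕ → ℝ → ℝ
  | 0 => f
  | (k + 1) => fun t => ∫ s in (0:ℝ)..t, convIter f k (t - s) * f s

noncomputable def resolventFn (a : ℝ) (f : ℝ → ℝ) (t : ℝ) : ℝ :=
  ∑' k : ℕ, a ^ (k + 1) * convIter f k t

noncomputable def resolventK (lamn γn β : ℝ) (R : ℝ → ℝ) {k : ℕ}
    (y : Fin k → ℝ) (t : ℝ) : ℝ :=
  lamn * Real.exp (-(β * t) / γn) * (∑ j, if t < y j then (1:ℝ) else 0)
    + lamn * ∫ s in (0:ℝ)..t,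
        (R (t - s) * Real.exp (-(β * s) / γn) * (∑ j, if s < y j then (1:ℝ) else 0))

open scoped FourierTransform InnerProductSpace in
lemma plancherel_le (f : ℝ → ℂ) (hf : Integrable f) (hf2 : MemLp f 2)
    (B : ℝ → ℝ) (hB : Integrable B) (hle : ∀ ξ, ‖𝓕 f ξ‖ ^ 2 ≤ B ξ) :
    ∫ x, ‖f x‖ ^ 2 ≤ ∫ ξ, B ξ := by
  have hcont : Continuous (𝓕 f) :=
    VectorFourier.fourierIntegral_continuous Real.continuous_fourierChar
      (by exact continuous_inner) hf
  have hI : Integrable (fun ξ => ‖𝓕 f ξ‖ ^ 2) :=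
    hB.mono' (hcont.norm.pow 2).aestronglyMeasurable (Eventually.of_forall fun ξ => by
      simpa using hle ξ)
  have hH : MemLp (𝓕 f) 2 := by
    rw [memLp_two_iff_integrable_sq_norm hcont.aestronglyMeasurable]; exact hI
  set G := hf2.toLp f
  set H := hH.toLp (𝓕 f)
  have key : ∀ φ : SchwartzMap ℝ ℂ, inner ℂ G ((𝓕⁻ φ).toLp 2) = inner ℂ H (φ.toLp 2) := by
    intro φ
    rw [L2.inner_def, L2.inner_def]
    have h1 : ∫ a, inner ℂ (G a) (((𝓕⁻ φ).toLp 2 : Lp ℂ 2) a) = ∫ a, inner ℂ (f a) (𝓕⁻ φ a) := by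
      apply integral_congr_ae
      filter_upwards [hf2.coeFn_toLp, (𝓕⁻ φ).coeFn_toLp 2 volume] with x h1 h2
      rw [h1, h2]
    have h2 : ∫ a, inner ℂ (H a) ((φ.toLp 2 : Lp ℂ 2) a) = ∫ a, inner ℂ (𝓕 f a) (φ a) := by
      apply integral_congr_ae
      filter_upwards [hH.coeFn_toLp, φ.coeFn_toLp 2 volume] with x h1 h2
      rw [h1, h2]
    rw [h1, h2]
    have := VectorFourier.integral_sesq_fourierIntegral_eq_neg_flip (innerSL ℂ)
      (L := innerₗ ℝ) Real.continuous_fourierChar continuous_inner hf (φ.integrable (μ := volume))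
    simpa [SchwartzMap.fourierInv_coe] using! this.symm
  have hb : ∀ ψ : Lp ℂ 2 (volume : Measure ℝ), ‖(inner ℂ G ψ : ℂ)‖ ≤ ‖H‖ * ‖ψ‖ := by
    intro ψ
    refine (SchwartzMap.denseRange_toLpCLM (E := ℝ) (F := ℂ) (p := 2) (μ := volume)
      ENNReal.ofNat_ne_top).induction_on
      (p := fun ψ => ‖(inner ℂ G ψ : ℂ)‖ ≤ ‖H‖ * ‖ψ‖) ψ ?_ ?_
    · exact isClosed_le (by fun_prop) (by fun_prop)
    · intro ψ
      have h := key (𝓕 ψ)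
      simp only [FourierTransform.fourierInv_fourier_eq] at h
      change ‖(inner ℂ G (ψ.toLp 2) : ℂ)‖ ≤ ‖H‖ * ‖ψ.toLp 2‖
      rw [h, ← SchwartzMap.norm_fourier_toL2_eq ψ]
      exact norm_inner_le_norm _ _
  have h1 := hb G
  have hGH : ‖G‖ ≤ ‖H‖ := by
    rcases (norm_nonneg G).eq_or_lt with h0 | h0
    · rw [← h0]; positivity
    · rw [inner_self_eq_norm_sq_to_K] at h1
      simp at h1
      nlinarith
  have hG : ‖G‖ ^ 2 = ∫ x, ‖f x‖ ^ 2 := by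
    have := L2.inner_def (𝕜 := ℂ) G G
    rw [inner_self_eq_norm_sq_to_K] at this
    have h2 : ∫ a, inner ℂ (G a) (G a) = ((∫ x, ‖f x‖ ^ 2 : ℝ) : ℂ) := by
      rw [← integral_complex_ofReal]
      apply integral_congr_ae
      filter_upwards [hf2.coeFn_toLp] with x h1
      rw [h1, inner_self_eq_norm_sq_to_K]; simp
    rw [h2] at this
    apply Complex.ofReal_injective
    rw [← this]
    simp
  have hHH : ‖H‖ ^ 2 = ∫ x, ‖𝓕 f x‖ ^ 2 := by
    have := L2.inner_def (𝕜 := ℂ) H H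
    rw [inner_self_eq_norm_sq_to_K] at this
    have h2 : ∫ a, inner ℂ (H a) (H a) = ((∫ x, ‖𝓕 f x‖ ^ 2 : ℝ) : ℂ) := by
      rw [← integral_complex_ofReal]
      apply integral_congr_ae
      filter_upwards [hH.coeFn_toLp] with x h1
      rw [h1, inner_self_eq_norm_sq_to_K]; simp
    rw [h2] at this
    apply Complex.ofReal_injective
    rw [← this]
    simp
  rw [← hG]
  calc ‖G‖ ^ 2 ≤ ‖H‖ ^ 2 := by gcongr
    _ = _ := hHH
    _ ≤ _ := integral_mono hI hB hle

/-- restriction to the half line -/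
noncomputable def hl (u : ℝ → ℝ) : ℝ → ℝ := (Ici (0:ℝ)).indicator u

/-- plain convolution -/
noncomputable def cv (u v : ℝ → ℝ) (t : ℝ) : ℝ := ∫ s, u (t - s) * v s

lemma hl_of_nonneg (u : ℝ → ℝ) {t : ℝ} (h : 0 ≤ t) : hl u t = u t := by
  simp [hl, h]

lemma hl_of_neg (u : ℝ → ℝ) {t : ℝ} (h : t < 0) : hl u t = 0 := by
  simp [hl, h]

lemma cv_neg (u v : ℝ → ℝ) {t : ℝ} (ht : t < 0) : cv (hl u) (hl v) t = 0 := by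
  unfold cv
  rw [← integral_zero ℝ ℝ (μ := volume)]
  congr 1; ext s
  rcases lt_or_ge s 0 with h | h
  · rw [hl_of_neg v h, mul_zero]
  · rw [hl_of_neg u (by linarith), zero_mul]

lemma cv_pos (u v : ℝ → ℝ) {t : ℝ} (ht : 0 ≤ t) :
    cv (hl u) (hl v) t = ∫ s in (0:ℝ)..t, u (t - s) * v s := by
  unfold cv
  rw [intervalIntegral.integral_of_le ht, ← integral_Icc_eq_integral_Ioc,
    ← integral_indicator measurableSet_Icc]
  congr 1; ext s
  by_cases h : s ∈ Icc 0 t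
  · rw [indicator_of_mem h, hl_of_nonneg v h.1, hl_of_nonneg u (by linarith [h.2])]
  · rw [indicator_of_notMem h]
    rcases lt_or_ge s 0 with h' | h'
    · rw [hl_of_neg v h', mul_zero]
    · rw [hl_of_neg u, zero_mul]
      by_contra hh
      exact h ⟨h', by linarith⟩

lemma cv_eq_conv (u v : ℝ → ℝ) :
    cv u v = MeasureTheory.convolution v u (ContinuousLinearMap.mul ℝ ℝ) volume := by
  ext t
  simp [cv, MeasureTheory.convolution, mul_comm]

lemma cv_integrable {u v : ℝ → ℝ} (hu : Integrable u) (hv : Integrable v) :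
    Integrable (cv u v) := by
  rw [cv_eq_conv]
  exact hv.integrable_convolution _ hu

lemma cv_integral {u v : ℝ → ℝ} (hu : Integrable u) (hv : Integrable v) :
    ∫ t, cv u v t = (∫ t, u t) * ∫ t, v t := by
  rw [cv_eq_conv, integral_convolution _ hv hu, ContinuousLinearMap.mul_apply', mul_comm]

lemma cv_integrand {u v : ℝ → ℝ} (hu : Integrable u) (hv : Integrable v) :
    Integrable (fun p : ℝ × ℝ => u (p.1 - p.2) * v p.2) (volume.prod volume) := by
  have := hv.convolution_integrand (ContinuousLinearMap.mul ℝ ℝ) hu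
  simpa [mul_comm] using this

lemma cv_measurable {u v : ℝ → ℝ} (hu : Measurable u) (hv : Measurable v) :
    Measurable (cv u v) := by
  have : StronglyMeasurable (fun p : ℝ × ℝ => u (p.1 - p.2) * v p.2) :=
    Measurable.stronglyMeasurable (by fun_prop)
  exact this.integral_prod_right'.measurable

open scoped FourierTransform in
lemma cv_fourier {u v : ℝ → ℝ} (hu : Integrable u) (hv : Integrable v) (ξ : ℝ) :
    𝓕 (fun t => (cv u v t : ℂ)) ξ
      = 𝓕 (fun t => (u t : ℂ)) ξ * 𝓕 (fun t => (v t : ℂ)) ξ := by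
  have h := Real.fourier_mul_convolution_eq (f₁ := fun t => (v t : ℂ)) (f₂ := fun t => (u t : ℂ))
    hv.ofReal hu.ofReal ξ
  rw [mul_comm, ← h]
  refine congrArg (fun w : ℝ → ℂ => 𝓕 w ξ) ?_
  ext t
  simp only [cv, MeasureTheory.convolution, ContinuousLinearMap.mul_apply']
  rw [← integral_complex_ofReal]
  congr 1; ext s; simp [mul_comm]

section res
variable {g : ℝ → ℝ} (hgm : Measurable g) (hg0 : ∀ t, 0 ≤ t → 0 ≤ g t)
  (hg1 : ∀ t, 0 ≤ t → g t ≤ 1) (hgi : Integrable (hl g))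

lemma hl_meas {u : ℝ → ℝ} (hu : Measurable u) : Measurable (hl u) :=
  hu.indicator measurableSet_Ici

lemma hl_nonneg {u : ℝ → ℝ} (hg0 : ∀ t, 0 ≤ t → 0 ≤ u t) (t : ℝ) : 0 ≤ hl u t := by
  rcases lt_or_ge t 0 with h | h
  · rw [hl_of_neg u h]
  · rw [hl_of_nonneg u h]; exact hg0 t h

lemma hl_le {u : ℝ → ℝ} {c : ℝ} (hc : 0 ≤ c) (hg0 : ∀ t, 0 ≤ t → u t ≤ c) (t : ℝ) : hl u t ≤ c := by
  rcases lt_or_ge t 0 with h | h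
  · rw [hl_of_neg u h]; exact hc
  · rw [hl_of_nonneg u h]; exact hg0 t h

lemma cI_succ (g : ℝ → ℝ) (k : ℕ) :
    hl (convIter g (k + 1)) = cv (hl (convIter g k)) (hl g) := by
  ext t
  rcases lt_or_ge t 0 with h | h
  · rw [hl_of_neg _ h, cv_neg _ _ h]
  · rw [hl_of_nonneg _ h, cv_pos _ _ h]; rfl

include hgm hg0 hg1 hgi in
lemma cI_props (k : ℕ) : Measurable (hl (convIter g k)) ∧ (∀ t, 0 ≤ hl (convIter g k) t) ∧
    (∀ t, hl (convIter g k) t ≤ (∫ t, hl g t) ^ k) ∧ Integrable (hl (convIter g k)) ∧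
    ∫ t, hl (convIter g k) t = (∫ t, hl g t) ^ (k + 1) := by
  induction k with
  | zero =>
    refine ⟨hl_meas hgm, hl_nonneg hg0, ?_, hgi, by simp [convIter]⟩
    intro t; simpa [convIter] using hl_le (u := g) zero_le_one hg1 t
  | succ k ih =>
    obtain ⟨i1, i2, i3, i4, i5⟩ := ih
    rw [cI_succ]
    refine ⟨cv_measurable i1 (hl_meas hgm), ?_, ?_, cv_integrable i4 hgi, ?_⟩
    · intro t
      exact integral_nonneg fun s => mul_nonneg (i2 _) (hl_nonneg hg0 _)
    · intro t
      unfold cv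
      rw [pow_succ, ← integral_const_mul]
      refine integral_mono_of_nonneg
        (Eventually.of_forall fun s => mul_nonneg (i2 _) (hl_nonneg hg0 _)) (hgi.const_mul _)
        (Eventually.of_forall fun s => ?_)
      exact mul_le_mul_of_nonneg_right (i3 _) (hl_nonneg hg0 _)
    · rw [cv_integral i4 hgi, i5]; ring

include hgm hg0 hg1 hgi in
lemma res_props {a : ℝ} (ha : 0 < a) (hq : a * ∫ t, hl g t < 1) :
    Measurable (hl (resolventFn a g)) ∧ (∀ t, 0 ≤ hl (resolventFn a g) t) ∧
    Integrable (hl (resolventFn a g)) ∧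
    ∀ t, hl (resolventFn a g) t = a * hl g t + a * cv (hl (resolventFn a g)) (hl g) t := by
  set η := ∫ t, hl g t with hη
  have hη0 : 0 ≤ η := integral_nonneg (hl_nonneg hg0)
  have hP := cI_props hgm hg0 hg1 hgi
  have hRe : ∀ t, hl (resolventFn a g) t = ∑' k : ℕ, a ^ (k + 1) * hl (convIter g k) t := by
    intro t
    rcases lt_or_ge t 0 with h | h
    · simp [hl_of_neg _ h]
    · simp only [hl_of_nonneg _ h]; rfl
  have hgeo : Summable (fun k : ℕ => (a * η) ^ k) :=
    summable_geometric_of_lt_one (by positivity) hq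
  have hsum : ∀ t, Summable (fun k : ℕ => a ^ (k + 1) * hl (convIter g k) t) := by
    intro t
    refine Summable.of_nonneg_of_le (fun k => mul_nonneg (by positivity) ((hP k).2.1 t))
      (fun k => ?_) (hgeo.mul_left a)
    calc a ^ (k + 1) * hl (convIter g k) t ≤ a ^ (k+1) * η ^ k := by
          gcongr; exact (hP k).2.2.1 t
      _ = _ := by rw [mul_pow]; ring
  have hnn : ∀ t, 0 ≤ hl (resolventFn a g) t := by
    intro t; rw [hRe]
    exact tsum_nonneg fun k => mul_nonneg (by positivity) ((hP k).2.1 t)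
  have hmeas : Measurable (hl (resolventFn a g)) := by
    refine measurable_of_tendsto_metrizable
      (f := fun N t => ∑ k ∈ Finset.range N, a ^ (k + 1) * hl (convIter g k) t) ?_ ?_
    · intro N
      exact Finset.measurable_sum _ fun k _ => (hP k).1.const_mul _
    · rw [tendsto_pi_nhds]
      intro t
      rw [hRe]
      exact (hsum t).hasSum.tendsto_sum_nat
  refine ⟨hmeas, hnn, ?_, ?_⟩
  · refine ⟨hmeas.aestronglyMeasurable, ?_⟩
    rw [hasFiniteIntegral_iff_ofReal (Eventually.of_forall hnn)]
    have : ∀ t, ENNReal.ofReal (hl (resolventFn a g) t)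
        = ∑' k : ℕ, ENNReal.ofReal (a ^ (k + 1) * hl (convIter g k) t) := by
      intro t
      rw [hRe, ENNReal.ofReal_tsum_of_nonneg
        (fun k => mul_nonneg (by positivity) ((hP k).2.1 t)) (hsum t)]
    simp_rw [this]
    rw [lintegral_tsum (fun k => (((hP k).1.const_mul _).ennreal_ofReal).aemeasurable)]
    have h2 : ∀ k : ℕ, ∫⁻ t, ENNReal.ofReal (a ^ (k + 1) * hl (convIter g k) t)
        = ENNReal.ofReal ((a * η) ^ (k + 1)) := by
      intro k
      rw [← ofReal_integral_eq_lintegral_ofReal ((hP k).2.2.2.1.const_mul _)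
        (Eventually.of_forall fun t => mul_nonneg (by positivity) ((hP k).2.1 t)),
        integral_const_mul, (hP k).2.2.2.2, mul_pow]
    simp_rw [h2]
    rw [← ENNReal.ofReal_tsum_of_nonneg (fun k => by positivity)
      ((summable_nat_add_iff 1).2 hgeo)]
    exact ENNReal.ofReal_lt_top
  · intro t
    have hint : ∀ k : ℕ, Integrable (fun s => (a ^ (k + 1) * hl (convIter g k) (t - s)) * hl g s) := by
      intro k
      refine (hgi.const_mul (a ^ (k+1) * η ^ k)).mono' ?_ (Eventually.of_forall fun s => ?_)
      · have := (hP k).1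
        have h2 := hl_meas hgm
        exact Measurable.aestronglyMeasurable (by fun_prop)
      · have h1 := (hP k).2.1 (t - s)
        have h2 := hl_nonneg hg0 s
        rw [Real.norm_of_nonneg (by positivity)]
        gcongr
        exact (hP k).2.2.1 _
    have hval : ∀ k : ℕ, ∫ s, (a ^ (k + 1) * hl (convIter g k) (t - s)) * hl g s
        = a ^ (k + 1) * hl (convIter g (k+1)) t := by
      intro k
      rw [cI_succ, cv, ← integral_const_mul]
      congr 1; ext s; ring
    have hnorm : ∀ k : ℕ, ∫ s, ‖(a ^ (k + 1) * hl (convIter g k) (t - s)) * hl g s‖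
        = a ^ (k + 1) * hl (convIter g (k+1)) t := by
      intro k
      rw [← hval]
      congr 1; ext s
      have h1 := (hP k).2.1 (t - s)
      have h2 := hl_nonneg hg0 s
      rw [Real.norm_of_nonneg (by positivity)]
    have hs2 : Summable (fun k : ℕ => a ^ (k + 1) * hl (convIter g (k+1)) t) := by
      have := ((summable_nat_add_iff 1).2 (hsum t)).mul_left a⁻¹
      refine this.congr fun k => ?_
      field_simp
      ring
    have hcv : cv (hl (resolventFn a g)) (hl g) t
        = ∑' k : ℕ, a ^ (k + 1) * hl (convIter g (k+1)) t := by
      have := integral_tsum_of_summable_integral_norm hint (by simp_rw [hnorm]; exact hs2)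
      simp_rw [hval] at this
      rw [this, cv]
      congr 1; ext s
      rw [hRe, tsum_mul_right]
    rw [hcv, hRe, (hsum t).tsum_eq_zero_add, ← tsum_mul_left]
    congr 1
    · simp [convIter]
    · congr 1; ext k; ring
end res

lemma window_one {R G : ℝ → ℝ} (hR : Integrable R) (hR0 : ∀ t, 0 ≤ R t)
    (hG : Integrable G) (hG0 : ∀ t, 0 ≤ G t) (hG1 : ∀ t, G t ≤ 1) (hGn : ∀ t, t < 0 → G t = 0)
    {a s₁ : ℝ} (ha : 0 < a) (hq : a * ∫ t, G t < 1) (hs : 0 < s₁) (has : a * s₁ ≤ 1 / 2)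
    (hV : ∀ t, R t = a * G t + a * cv R G t) (T : ℝ) :
    (∫ t in Iic T, R t) - ∫ t in Iic (T - s₁), R t ≤ 2 := by
  set M : ℝ → ℝ := fun T => ∫ t in Iic T, R t with hM
  have hMmono : Monotone M := fun x y hxy =>
    setIntegral_mono_set hR.integrableOn (Eventually.of_forall hR0)
      (LE.le.eventuallyLE (Iic_subset_Iic.2 hxy))
  have hM0 : ∀ x, 0 ≤ M x := fun x => integral_nonneg hR0
  have hMle : ∀ x, M x ≤ ∫ t, R t := fun x => setIntegral_le_integral hR (Eventually.of_forall hR0)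
  have hη0 : 0 ≤ ∫ t, G t := integral_nonneg hG0
  have hcvi := cv_integrable hR hG
  have hF : ∫ t in Iic T, cv R G t = ∫ s, M (T - s) * G s := by
    have h1 : ∫ t in Iic T, cv R G t = ∫ t in Iic T, ∫ s, R (t - s) * G s := rfl
    rw [h1, integral_integral_swap]
    · congr 1; ext s
      rw [integral_mul_const]
      congr 1
      simp only [hM]
      rw [← integral_indicator measurableSet_Iic, ← integral_indicator measurableSet_Iic,
        ← integral_sub_right_eq_self ((Iic (T - s)).indicator fun t => R t) s]
      congr 1; ext t
      simp [indicator]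
    · have := cv_integrand hR hG
      have h3 := this.mono_measure (μ := (volume.restrict (Iic T)).prod volume)
        (Measure.prod_mono Measure.restrict_le_self le_rfl)
      exact h3
  have hMT : M T = a * (∫ t in Iic T, G t) + a * ∫ s, M (T - s) * G s := by
    have : M T = ∫ t in Iic T, (a * G t + a * cv R G t) := by
      simp only [hM]; congr 1; ext t; exact hV t
    rw [this, integral_add (hG.integrableOn.const_mul a) (hcvi.integrableOn.const_mul a),
      integral_const_mul, integral_const_mul, hF]
  have h1 : ∫ t in Iic T, G t ≤ ∫ t, G t := setIntegral_le_integral hG (Eventually.of_forall hG0)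
  have hΔ : 0 ≤ M T - M (T - s₁) := by linarith [hMmono (show T - s₁ ≤ T by linarith)]
  have hind : Integrable ((Icc 0 s₁).indicator (fun _ : ℝ => M T - M (T - s₁))) := by
    rw [integrable_indicator_iff measurableSet_Icc]
    exact integrableOn_const (by simp)
  have h2 : ∫ s, M (T - s) * G s ≤ (M T - M (T - s₁)) * s₁ + M (T - s₁) * ∫ t, G t := by
    have : (M T - M (T - s₁)) * s₁ + M (T - s₁) * ∫ t, G t
        = ∫ s, ((Icc 0 s₁).indicator (fun _ : ℝ => M T - M (T - s₁)) s + M (T - s₁) * G s) := by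
      rw [integral_add hind (hG.const_mul _), integral_const_mul,
        integral_indicator measurableSet_Icc]
      simp [hs.le, mul_comm]
    rw [this]
    refine integral_mono_of_nonneg (Eventually.of_forall fun s => mul_nonneg (hM0 _) (hG0 _))
      (hind.add (hG.const_mul _)) (Eventually.of_forall fun s => ?_)
    simp only
    rcases lt_or_ge s 0 with h | h
    · rw [hGn s h]
      simp only [mul_zero, add_zero]
      exact indicator_nonneg (fun _ _ => hΔ) _
    · rcases le_or_gt s s₁ with h' | h'
      · rw [indicator_of_mem (by exact ⟨h, h'⟩)]
        have e1 : M (T - s) ≤ M T := hMmono (by linarith)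
        nlinarith [hG0 s, hG1 s, mul_le_mul_of_nonneg_right e1 (hG0 s),
          mul_le_mul_of_nonneg_left (hG1 s) hΔ]
      · rw [indicator_of_notMem (by simp [h'])]
        have e1 : M (T - s) ≤ M (T - s₁) := hMmono (by linarith)
        simpa using mul_le_mul_of_nonneg_right e1 (hG0 s)
  have h3 : M T ≤ a * (∫ t, G t) + a * ((M T - M (T - s₁)) * s₁ + M (T - s₁) * ∫ t, G t) := by
    have e1 := mul_le_mul_of_nonneg_left h1 ha.le
    have e2 := mul_le_mul_of_nonneg_left h2 ha.le
    linarith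
  have h4 : M (T - s₁) * (a * ∫ t, G t) ≤ M (T - s₁) := by
    nlinarith [hM0 (T - s₁)]
  have h5 : (M T - M (T - s₁)) * (a * s₁) ≤ (M T - M (T - s₁)) * (1/2) := by gcongr
  nlinarith

lemma window_iter {R : ℝ → ℝ} {s₁ : ℝ} (hs : 0 < s₁)
    (hR : Integrable R) (hR0 : ∀ t, 0 ≤ R t)
    (h : ∀ T, (∫ t in Iic T, R t) - ∫ t in Iic (T - s₁), R t ≤ 2)
    {y : ℝ} (hy : 0 ≤ y) (T : ℝ) :
    (∫ t in Iic T, R t) - ∫ t in Iic (T - y), R t ≤ 2 * (y / s₁ + 1) := by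
  have hi : ∀ N : ℕ, (∫ t in Iic T, R t) - ∫ t in Iic (T - N * s₁), R t ≤ 2 * N := by
    intro N
    induction N with
    | zero => simp
    | succ N ih =>
      have := h (T - N * s₁)
      rw [show T - N * s₁ - s₁ = T - ((N + 1 : ℕ) : ℝ) * s₁ by push_cast; ring] at this
      push_cast at this ⊢
      linarith
  have h1 := hi ⌈y / s₁⌉₊
  have h2 : (⌈y / s₁⌉₊ : ℝ) < y / s₁ + 1 := Nat.ceil_lt_add_one (by positivity)
  have h3 : y ≤ ⌈y / s₁⌉₊ * s₁ := by
    rw [← div_le_iff₀ hs]; exact Nat.le_ceil _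
  have h4 : ∫ t in Iic (T - ⌈y / s₁⌉₊ * s₁), R t ≤ ∫ t in Iic (T - y), R t :=
    setIntegral_mono_set hR.integrableOn (Eventually.of_forall hR0)
      (LE.le.eventuallyLE (Iic_subset_Iic.2 (by linarith)))
  linarith

lemma window_cv {R : ℝ → ℝ} (hR : Integrable R) {y : ℝ} (hy : 0 ≤ y) (t : ℝ) :
    ∫ s, R (t - s) * (Ico 0 y).indicator (fun _ => (1:ℝ)) s
      = (∫ t in Iic t, R t) - ∫ u in Iic (t - y), R u := by
  have h1 : ∫ s, R (t - s) * (Ico 0 y).indicator (fun _ => (1:ℝ)) s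
      = ∫ s, (Ioc (t - y) t).indicator R s := by
    rw [← integral_sub_left_eq_self _ volume t]
    congr 1; ext s
    simp only [indicator, mem_Ico, mem_Ioc, sub_sub_cancel]
    have : (0 ≤ t - s ∧ t - s < y) ↔ (t - y < s ∧ s ≤ t) := by
      constructor <;> rintro ⟨h, h'⟩ <;> constructor <;> linarith
    rw [if_congr this rfl rfl]
    split_ifs <;> simp
  rw [h1, integral_indicator measurableSet_Ioc, ← intervalIntegral.integral_of_le (by linarith),
    intervalIntegral.integral_Iic_sub_Iic hR.integrableOn hR.integrableOn]

open scoped FourierTransform in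
/-- L2 bound on differences from Fourier decay. -/
lemma diff_sq_le {F : ℝ → ℝ} (hF : Integrable F) {S K : ℝ} (hF0 : ∀ t, 0 ≤ F t)
    (hFS : ∀ t, F t ≤ S)
    (hK : ∀ ξ, |ξ| * ‖𝓕 (fun t => (F t : ℂ)) ξ‖ ≤ K) {h : ℝ} (hh : 0 < h) :
    Integrable (fun t => (F (t + h) - F t) ^ 2) ∧
    ∫ t, (F (t + h) - F t) ^ 2 ≤ 10 * Real.pi ^ 2 * K ^ 2 * h := by
  have hDi : Integrable (fun t => F (t + h) - F t) := (hF.comp_add_right h).sub hF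
  have hS : ∀ t, |F (t + h) - F t| ≤ S := fun t => by
    rw [abs_le]; constructor <;> linarith [hF0 t, hF0 (t + h), hFS t, hFS (t + h)]
  have hsq : Integrable (fun t => (F (t + h) - F t) ^ 2) := by
    refine (hDi.norm.const_mul S).mono' (hDi.aestronglyMeasurable.pow 2)
      (Eventually.of_forall fun t => ?_)
    rw [Real.norm_of_nonneg (sq_nonneg _), Real.norm_eq_abs, ← sq_abs, sq]
    exact mul_le_mul_of_nonneg_right (hS t) (abs_nonneg _)
  refine ⟨hsq, ?_⟩
  set f : ℝ → ℂ := fun t => ((F (t + h) - F t : ℝ) : ℂ) with hf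
  have hfi : Integrable f := hDi.ofReal
  have hf2 : MemLp f 2 := by
    rw [memLp_two_iff_integrable_sq_norm hfi.aestronglyMeasurable]
    refine hsq.congr (Eventually.of_forall fun t => ?_)
    simp only [hf, Complex.norm_real, Real.norm_eq_abs, sq_abs]
  have hft : ∀ ξ, 𝓕 f ξ = (Complex.exp (((2 * Real.pi * h * ξ : ℝ) : ℂ) * Complex.I) - 1)
      * 𝓕 (fun t => (F t : ℂ)) ξ := by
    intro ξ
    have e0 : ∀ w : ℝ → ℂ, 𝓕 w ξ = ∫ v, Complex.exp (((-2 * Real.pi * v * ξ : ℝ):ℂ) * Complex.I) * w v := by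
      intro w
      rw [Real.fourier_real_eq_integral_exp_smul]
      simp
    have hint : Integrable (fun v => Complex.exp (((-2 * Real.pi * v * ξ : ℝ):ℂ) * Complex.I) * (F v : ℂ)) := by
      refine hF.ofReal.bdd_mul (c := 1) (Continuous.aestronglyMeasurable (by fun_prop)) (Eventually.of_forall fun v => ?_)
      rw [Complex.norm_exp_ofReal_mul_I]
    have hint2 : Integrable (fun v => Complex.exp (((-2 * Real.pi * v * ξ : ℝ):ℂ) * Complex.I) * (F (v + h) : ℂ)) := by
      refine (hF.comp_add_right h).ofReal.bdd_mul (c := 1) (Continuous.aestronglyMeasurable (by fun_prop)) (Eventually.of_forall fun v => ?_)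
      rw [Complex.norm_exp_ofReal_mul_I]
    rw [e0, e0, sub_mul, one_mul]
    have e1 : ∫ v, Complex.exp (((-2 * Real.pi * v * ξ : ℝ):ℂ) * Complex.I) * (F (v + h) : ℂ)
        = Complex.exp (((2 * Real.pi * h * ξ : ℝ) : ℂ) * Complex.I) *
          ∫ v, Complex.exp (((-2 * Real.pi * v * ξ : ℝ):ℂ) * Complex.I) * (F v : ℂ) := by
      rw [← integral_const_mul, ← integral_add_right_eq_self (fun v =>
        Complex.exp (((2 * Real.pi * h * ξ : ℝ) : ℂ) * Complex.I) *
        (Complex.exp (((-2 * Real.pi * v * ξ : ℝ):ℂ) * Complex.I) * (F v : ℂ))) h]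
      congr 1; ext v
      rw [← mul_assoc, ← Complex.exp_add]
      congr 2
      push_cast; ring
    rw [← e1, ← integral_sub hint2 hint]
    congr 1; ext v
    simp only [hf]; push_cast; ring
  set A := 2 * Real.pi * h with hA
  have hA0 : 0 < A := by positivity
  have hKn : 0 ≤ K := le_trans (by positivity) (hK 0)
  have hle : ∀ ξ, ‖𝓕 f ξ‖ ^ 2 ≤ 5 * A ^ 2 * K ^ 2 * (1 + (A * ξ) ^ 2)⁻¹ := by
    intro ξ
    rw [hft, norm_mul, mul_pow, ← div_eq_mul_inv, le_div_iff₀ (by positivity)]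
    set E := ‖Complex.exp (((A * ξ : ℝ) : ℂ) * Complex.I) - 1‖
    set N := ‖𝓕 (fun t => (F t : ℂ)) ξ‖
    have hE1 : E ≤ 2 := by
      refine (norm_sub_le _ _).trans ?_
      rw [Complex.norm_exp_ofReal_mul_I]; norm_num
    have hE2 : E ≤ |A * ξ| := by
      have := Real.norm_exp_I_mul_ofReal_sub_one_le (x := A * ξ)
      rw [mul_comm] at this
      simpa [E] using this
    have hE0 : 0 ≤ E := norm_nonneg _
    have hN0 : 0 ≤ N := norm_nonneg _
    have h1 : E ^ 2 ≤ 4 := by nlinarith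
    have h2 : E ^ 2 ≤ (A * ξ) ^ 2 := by rw [← sq_abs (A * ξ)]; gcongr
    have h3 : (|ξ| * N) ^ 2 ≤ K ^ 2 := by gcongr; exact hK ξ
    rw [mul_pow, sq_abs] at h3
    have h4 : E ^ 2 * (1 + (A * ξ) ^ 2) ≤ 5 * (A * ξ) ^ 2 := by nlinarith [sq_nonneg (A * ξ)]
    calc E ^ 2 * N ^ 2 * (1 + (A * ξ) ^ 2) = (E ^ 2 * (1 + (A * ξ) ^ 2)) * N ^ 2 := by ring
      _ ≤ (5 * (A * ξ) ^ 2) * N ^ 2 := by gcongr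
      _ = 5 * A ^ 2 * (ξ ^ 2 * N ^ 2) := by ring
      _ ≤ _ := by gcongr
  have hBi : Integrable (fun ξ : ℝ => 5 * A ^ 2 * K ^ 2 * (1 + (A * ξ) ^ 2)⁻¹) :=
    (integrable_inv_one_add_sq.comp_mul_left' hA0.ne').const_mul _
  have := plancherel_le f hfi hf2 _ hBi hle
  have e2 : ∫ x, ‖f x‖ ^ 2 = ∫ t, (F (t + h) - F t) ^ 2 := by
    congr 1; ext t
    simp only [hf, Complex.norm_real, Real.norm_eq_abs, sq_abs]
  rw [e2] at this
  refine this.trans (le_of_eq ?_)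
  rw [integral_const_mul, Measure.integral_comp_mul_left (fun x : ℝ => (1 + x ^ 2)⁻¹) A,
    integral_univ_inv_one_add_sq, abs_of_pos (by positivity), smul_eq_mul, hA]
  field_simp
  ring

open scoped FourierTransform in
/-- the real form of the Fourier integral on the half line -/
lemma fourier_exp_ind {ε y : ℝ} (hε : 0 ≤ ε) (hy : 0 ≤ y) (ξ : ℝ) :
    |ξ| * ‖𝓕 (fun t => (((Ico 0 y).indicator (fun s => Real.exp (-(ε * s))) t : ℝ) : ℂ)) ξ‖ ≤ 1 := by
  rcases eq_or_ne ξ 0 with rfl | hξ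
  · simp
  rw [Real.fourier_real_eq_integral_exp_smul]
  set z : ℂ := -(ε : ℂ) - 2 * Real.pi * ξ * Complex.I with hz
  have hzim : z.im = -(2 * Real.pi * ξ) := by simp [hz]
  have hz0 : z ≠ 0 := by
    intro h
    rw [h] at hzim
    have : 2 * Real.pi * ξ ≠ 0 := by have := Real.pi_pos; positivity
    apply this; simp at hzim; simp [hzim]
  have h1 : ∫ v, Complex.exp (((-2 * Real.pi * v * ξ : ℝ):ℂ) * Complex.I) •
      (((Ico 0 y).indicator (fun s => Real.exp (-(ε * s))) v : ℝ) : ℂ)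
      = ∫ v in (0:ℝ)..y, Complex.exp (z * v) := by
    rw [intervalIntegral.integral_of_le hy, ← integral_Ico_eq_integral_Ioc,
      ← integral_indicator measurableSet_Ico]
    congr 1; ext v
    by_cases hv : v ∈ Ico 0 y
    · rw [indicator_of_mem hv, indicator_of_mem hv, smul_eq_mul, Complex.ofReal_exp,
        ← Complex.exp_add]
      congr 1
      rw [hz]; push_cast; ring
    · rw [indicator_of_notMem hv, indicator_of_notMem hv]; simp
  rw [h1, integral_exp_mul_complex hz0]
  have hzn : 2 * Real.pi * |ξ| ≤ ‖z‖ := by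
    have := Complex.abs_im_le_norm z
    rw [hzim, abs_neg, abs_mul, abs_of_pos (by positivity)] at this
    exact this
  have hnum : ‖Complex.exp (z * y) - Complex.exp (z * (0:ℝ))‖ ≤ 2 := by
    refine (norm_sub_le _ _).trans ?_
    rw [Complex.norm_exp, Complex.norm_exp]
    have e1 : (z * y).re = -(ε * y) := by simp [hz]
    have e2 : (z * (0:ℝ)).re = 0 := by simp
    rw [e1, e2, Real.exp_zero]
    have : Real.exp (-(ε * y)) ≤ 1 := Real.exp_le_one_iff.2 (by nlinarith)
    linarith
  rw [norm_div]
  have hξ' : 0 < |ξ| := abs_pos.2 hξ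
  have hpi := Real.pi_gt_three
  have hzpos : 0 < ‖z‖ := norm_pos_iff.2 hz0
  rw [← mul_div_assoc, div_le_one hzpos]
  nlinarith

open scoped FourierTransform in
lemma fourier_add_const {u v : ℝ → ℝ} (hu : Integrable u) (hv : Integrable v) (b c : ℝ) (ξ : ℝ) :
    𝓕 (fun t => ((b * u t + c * v t : ℝ) : ℂ)) ξ
      = b * 𝓕 (fun t => (u t : ℂ)) ξ + c * 𝓕 (fun t => (v t : ℂ)) ξ := by
  have e0 : ∀ w : ℝ → ℂ, 𝓕 w ξ = ∫ v, Complex.exp (((-2 * Real.pi * v * ξ : ℝ):ℂ) * Complex.I) * w v := by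
    intro w
    rw [Real.fourier_real_eq_integral_exp_smul]
    simp
  have hint : ∀ w : ℝ → ℝ, Integrable w → Integrable (fun v =>
      Complex.exp (((-2 * Real.pi * v * ξ : ℝ):ℂ) * Complex.I) * (w v : ℂ)) := by
    intro w hw
    refine hw.ofReal.bdd_mul (c := 1) (Continuous.aestronglyMeasurable (by fun_prop))
      (Eventually.of_forall fun v => ?_)
    rw [Complex.norm_exp_ofReal_mul_I]
  rw [e0, e0, e0, ← integral_const_mul, ← integral_const_mul,
    ← integral_add ((hint u hu).const_mul _) ((hint v hv).const_mul _)]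
  congr 1; ext t; push_cast; ring

open scoped FourierTransform in
lemma fourier_norm_le {u : ℝ → ℝ} (hu0 : ∀ t, 0 ≤ u t) (ξ : ℝ) :
    ‖𝓕 (fun t => (u t : ℂ)) ξ‖ ≤ ∫ t, u t := by
  rw [Real.fourier_real_eq_integral_exp_smul]
  refine (norm_integral_le_integral_norm _).trans (le_of_eq ?_)
  congr 1; ext t
  rw [norm_smul, Complex.norm_exp_ofReal_mul_I, one_mul, Complex.norm_real,
    Real.norm_of_nonneg (hu0 t)]

/-- one building block -/
noncomputable def blk (ε y : ℝ) : ℝ → ℝ := (Ico 0 y).indicator (fun s => Real.exp (-(ε * s)))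

lemma blk_nonneg (ε y t : ℝ) : 0 ≤ blk ε y t := indicator_nonneg (fun _ _ => (Real.exp_pos _).le) _

lemma blk_le_ind {ε : ℝ} (hε : 0 ≤ ε) (y t : ℝ) :
    blk ε y t ≤ (Ico 0 y).indicator (fun _ => (1:ℝ)) t := by
  unfold blk
  by_cases h : t ∈ Ico 0 y
  · rw [indicator_of_mem h, indicator_of_mem h]
    exact Real.exp_le_one_iff.2 (by nlinarith [h.1])
  · rw [indicator_of_notMem h, indicator_of_notMem h]

lemma blk_meas (ε y : ℝ) : Measurable (blk ε y) :=
  Measurable.indicator (by fun_prop) measurableSet_Ico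

lemma ind_int (y : ℝ) : Integrable ((Ico 0 y).indicator (fun _ => (1:ℝ))) := by
  rw [integrable_indicator_iff measurableSet_Ico]
  exact integrableOn_const (by simp)

lemma blk_int {ε : ℝ} (hε : 0 ≤ ε) (y : ℝ) : Integrable (blk ε y) :=
  (ind_int y).mono' (blk_meas ε y).aestronglyMeasurable (Eventually.of_forall fun t => by
    rw [Real.norm_of_nonneg (blk_nonneg _ _ _)]; exact blk_le_ind hε y t)

lemma blk_integral_le {ε : ℝ} (hε : 0 ≤ ε) {y : ℝ} (hy : 0 ≤ y) : ∫ t, blk ε y t ≤ y := by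
  refine (integral_mono (blk_int hε y) (ind_int y) (blk_le_ind hε y)).trans ?_
  rw [integral_indicator measurableSet_Ico]
  simp [hy]

lemma cv_blk_int {ε : ℝ} (hε : 0 ≤ ε) (y : ℝ) {R : ℝ → ℝ} (hR : Integrable R) (t : ℝ) :
    Integrable (fun s => R (t - s) * blk ε y s) := by
  have h1 : Integrable (fun s => R (t - s)) := hR.comp_sub_left t
  have := h1.bdd_mul (c := 1) (blk_meas ε y).aestronglyMeasurable (Eventually.of_forall fun s => by
    rw [Real.norm_of_nonneg (blk_nonneg _ _ _)]
    exact (blk_le_ind hε y s).trans (indicator_le' (fun _ _ => le_rfl) (fun _ _ => zero_le_one) s))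
  exact this.congr (Eventually.of_forall fun s => mul_comm _ _)

open scoped FourierTransform in
/-- The main estimate for a single index. -/
lemma single_est {g : ℝ → ℝ} (hgm : Measurable g) (hg0 : ∀ t, 0 ≤ t → 0 ≤ g t)
    (hg1 : ∀ t, 0 ≤ t → g t ≤ 1) (hgi : Integrable (hl g))
    {a lam γ β c s₁ : ℝ} (ha : 0 < a) (hq : a * ∫ t, hl g t < 1) (hlam : 0 < lam) (hγ : 0 < γ)
    (hβ : 0 ≤ β) (hc : 0 < c) (hs : 0 < s₁) (has : a * s₁ ≤ 1 / 2)
    (hlow : ∀ ξ : ℝ, c * min 1 |ξ| ≤ ‖1 - a * 𝓕 (fun t => (hl g t : ℂ)) ξ‖)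
    {κ δ : ℝ} (hκ : 1 ≤ κ) (hδ : 0 ≤ δ) {k : ℕ} (y : Fin k → ℝ) (hy : ∀ j, 0 ≤ y j) :
    (∫ t : ℝ,
      |(if γ * (t + δ) < 0 then (0:ℝ)
          else resolventK lam γ β (resolventFn a g) y (γ * (t + δ))) -
        (if γ * t < 0 then (0:ℝ)
          else resolventK lam γ β (resolventFn a g) y (γ * t))| ^ (2 * κ))
      ≤ 10 * Real.pi ^ 2 * (lam * (3 + 2 / s₁)) ^ (2 * κ - 2) * (lam / c) ^ 2
        * (∑ j, (1 + y j)) ^ (2 * κ) * δ := by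
  obtain ⟨hRm, hR0, hRi, hV⟩ := res_props hgm hg0 hg1 hgi ha hq
  set R := hl (resolventFn a g) with hR
  set ε := β / γ with hε
  have hε0 : 0 ≤ ε := by positivity
  set Y := ∑ j, (1 + y j) with hY
  have hY0 : 0 ≤ Y := Finset.sum_nonneg fun j _ => by linarith [hy j]
  set f : ℝ → ℝ := fun s => Real.exp (-(β * s) / γ) * (∑ j, if s < y j then (1:ℝ) else 0) with hf
  have hfe : ∀ s, hl f s = ∑ j, blk ε (y j) s := by
    intro s
    rcases lt_or_ge s 0 with h | h
    · rw [hl_of_neg _ h]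
      symm; apply Finset.sum_eq_zero
      intro j _
      exact indicator_of_notMem (by simp [h]) _
    · rw [hl_of_nonneg _ h]
      simp only [hf, Finset.mul_sum]
      refine Finset.sum_congr rfl fun j _ => ?_
      unfold blk
      by_cases h' : s < y j
      · rw [if_pos h', indicator_of_mem (by exact ⟨h, h'⟩), mul_one, hε]
        congr 1; ring
      · rw [if_neg h', indicator_of_notMem (by simp [h']), mul_zero]
  have hfe' : hl f = fun s => ∑ j, blk ε (y j) s := funext hfe
  have hfi : Integrable (hl f) := by
    rw [hfe']; exact integrable_finsetSum _ fun j _ => blk_int hε0 _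
  have hf0 : ∀ s, 0 ≤ hl f s := fun s => by
    rw [hfe]; exact Finset.sum_nonneg fun j _ => blk_nonneg _ _ _
  set F : ℝ → ℝ := fun u => lam * hl f u + lam * cv R (hl f) u with hFdef
  have hFe : ∀ u, (if u < 0 then (0:ℝ) else resolventK lam γ β (resolventFn a g) y u) = F u := by
    intro u
    split_ifs with h
    · simp only [hFdef]
      rw [hl_of_neg _ h, hR, cv_neg _ _ h]; simp
    · rw [not_lt] at h
      simp only [hFdef]
      rw [hl_of_nonneg _ h, hR, cv_pos _ _ h]
      unfold resolventK
      simp only [hf]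
      congr 1
      · ring
      · congr 2; ext s; ring
  simp_rw [hFe]
  have hcvi := cv_integrable hRi hfi
  have hFi : Integrable F := (hfi.const_mul lam).add (hcvi.const_mul lam)
  have hF0 : ∀ u, 0 ≤ F u := fun u => add_nonneg (mul_nonneg hlam.le (hf0 u))
    (mul_nonneg hlam.le (integral_nonneg fun s => mul_nonneg (hR0 _) (hf0 _)))
  have hwin := window_one hRi hR0 hgi (hl_nonneg hg0) (hl_le zero_le_one hg1)
    (fun t ht => hl_of_neg g ht) ha hq hs has hV
  have hFS : ∀ u, F u ≤ lam * (3 + 2 / s₁) * Y := by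
    intro u
    have h1 : hl f u ≤ ∑ j : Fin k, (1:ℝ) := by
      rw [hfe]
      refine Finset.sum_le_sum fun j _ => (blk_le_ind hε0 _ _).trans ?_
      exact indicator_le' (fun _ _ => le_rfl) (fun _ _ => zero_le_one) u
    have h2 : cv R (hl f) u ≤ ∑ j, 2 * (y j / s₁ + 1) := by
      unfold cv
      simp_rw [hfe, Finset.mul_sum]
      rw [integral_finsetSum _ fun j _ => cv_blk_int hε0 _ hRi u]
      refine Finset.sum_le_sum fun j _ => ?_
      have h3 := window_iter hs hRi hR0 hwin (hy j) u
      rw [← window_cv hRi (hy j) u] at h3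
      refine le_trans ?_ h3
      refine integral_mono_of_nonneg
        (Eventually.of_forall fun s => mul_nonneg (hR0 _) (blk_nonneg _ _ _)) ?_
        (Eventually.of_forall fun s => mul_le_mul_of_nonneg_left (blk_le_ind hε0 _ _) (hR0 _))
      have := cv_blk_int (le_refl (0:ℝ)) (y j) hRi u
      refine this.congr (Eventually.of_forall fun s => ?_)
      simp [blk]
    have h4 : ∑ j : Fin k, (1:ℝ) + ∑ j, 2 * (y j / s₁ + 1) ≤ (3 + 2 / s₁) * Y := by
      rw [hY, Finset.mul_sum, ← Finset.sum_add_distrib]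
      refine Finset.sum_le_sum fun j _ => ?_
      have : 0 ≤ 2 / s₁ := by positivity
      have h5 : 2 * (y j / s₁ + 1) = 2 / s₁ * y j + 2 := by ring
      rw [h5]
      nlinarith [hy j]
    simp only [hFdef]
    calc lam * hl f u + lam * cv R (hl f) u = lam * (hl f u + cv R (hl f) u) := by ring
      _ ≤ lam * ((3 + 2 / s₁) * Y) := by gcongr; linarith
      _ = _ := by ring
  set S := lam * (3 + 2 / s₁) * Y with hS
  set K := lam / c * Y with hK
  have hS0 : 0 ≤ S := by positivity
  -- Fourier side
  have hFK : ∀ ξ, |ξ| * ‖𝓕 (fun t => (F t : ℂ)) ξ‖ ≤ K := by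
    intro ξ
    have e1 : 𝓕 (fun t => (F t : ℂ)) ξ = lam * 𝓕 (fun t => (hl f t : ℂ)) ξ *
        (1 + 𝓕 (fun t => (R t : ℂ)) ξ) := by
      have := fourier_add_const hfi hcvi lam lam ξ
      rw [cv_fourier hRi hfi] at this
      simp only [hFdef]
      rw [this]; ring
    have e2 : 𝓕 (fun t => (R t : ℂ)) ξ = a * 𝓕 (fun t => (hl g t : ℂ)) ξ
        + a * (𝓕 (fun t => (R t : ℂ)) ξ * 𝓕 (fun t => (hl g t : ℂ)) ξ) := by
      have := fourier_add_const hgi (cv_integrable hRi hgi) a a ξ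
      rw [cv_fourier hRi hgi] at this
      rw [← this]
      simp only [← hV]
    have e3 : (1 + 𝓕 (fun t => (R t : ℂ)) ξ) * (1 - a * 𝓕 (fun t => (hl g t : ℂ)) ξ) = 1 := by
      linear_combination e2
    have b1 : ‖𝓕 (fun t => (hl f t : ℂ)) ξ‖ ≤ Y := by
      refine (fourier_norm_le hf0 ξ).trans ?_
      rw [hfe', integral_finsetSum _ fun j _ => blk_int hε0 _]
      exact Finset.sum_le_sum fun j _ => (blk_integral_le hε0 (hy j)).trans (by linarith)
    have b2 : |ξ| * ‖𝓕 (fun t => (hl f t : ℂ)) ξ‖ ≤ Y := by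
      have : 𝓕 (fun t => (hl f t : ℂ)) ξ = ∑ j, 𝓕 (fun t => (blk ε (y j) t : ℂ)) ξ := by
        simp_rw [Real.fourier_real_eq_integral_exp_smul]
        rw [← integral_finsetSum]
        · congr 1; ext t
          rw [hfe]; push_cast; rw [Finset.smul_sum]
        · intro j _
          simp only [smul_eq_mul]
          refine (blk_int hε0 (y j)).ofReal.bdd_mul (c := 1)
            (Continuous.aestronglyMeasurable (by fun_prop)) (Eventually.of_forall fun v => ?_)
          rw [Complex.norm_exp_ofReal_mul_I]
      rw [this]
      calc |ξ| * ‖∑ j, 𝓕 (fun t => (blk ε (y j) t : ℂ)) ξ‖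
          ≤ |ξ| * ∑ j, ‖𝓕 (fun t => (blk ε (y j) t : ℂ)) ξ‖ := by
            gcongr; exact norm_sum_le _ _
        _ = ∑ j, |ξ| * ‖𝓕 (fun t => (blk ε (y j) t : ℂ)) ξ‖ := by rw [Finset.mul_sum]
        _ ≤ Y := Finset.sum_le_sum fun j _ => (fourier_exp_ind hε0 (hy j) ξ).trans
            (by linarith [hy j])
    have e4 : ‖1 + 𝓕 (fun t => (R t : ℂ)) ξ‖ * ‖1 - a * 𝓕 (fun t => (hl g t : ℂ)) ξ‖ = 1 := by
      rw [← norm_mul, e3, norm_one]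
    rw [e1, norm_mul, norm_mul, Complex.norm_real, Real.norm_of_nonneg hlam.le]
    set P := ‖1 + 𝓕 (fun t => (R t : ℂ)) ξ‖
    set Q := ‖1 - a * 𝓕 (fun t => (hl g t : ℂ)) ξ‖
    set N := ‖𝓕 (fun t => (hl f t : ℂ)) ξ‖
    have hl1 := hlow ξ
    have hP : 0 ≤ P := norm_nonneg _
    have hN : 0 ≤ N := norm_nonneg _
    have h5 : |ξ| * N ≤ min 1 |ξ| * Y := by
      rcases le_total 1 |ξ| with h | h
      · rw [min_eq_left h, one_mul]; exact b2
      · rw [min_eq_right h]; gcongr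
    have h6 : P * (c * min 1 |ξ|) ≤ 1 :=
      (mul_le_mul_of_nonneg_left hl1 hP).trans e4.le
    rw [hK, div_mul_eq_mul_div, le_div_iff₀ hc]
    calc |ξ| * (lam * N * P) * c = lam * P * c * (|ξ| * N) := by ring
      _ ≤ lam * P * c * (min 1 |ξ| * Y) := by gcongr
      _ = lam * (P * (c * min 1 |ξ|)) * Y := by ring
      _ ≤ lam * 1 * Y := by gcongr
      _ = _ := by ring
  rcases hδ.eq_or_lt with rfl | hδ
  · simp only [add_zero, sub_self, abs_zero, mul_zero]
    rw [Real.zero_rpow (by positivity)]; simp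
  have hh : 0 < γ * δ := by positivity
  obtain ⟨hsqi, hsq⟩ := diff_sq_le hFi hF0 hFS hFK hh
  have hcv := Measure.integral_comp_mul_left (fun u => |F (u + γ * δ) - F u| ^ (2 * κ)) γ
  simp_rw [mul_add]
  rw [hcv, abs_of_pos (by positivity), smul_eq_mul]
  have hmain : ∫ u, |F (u + γ * δ) - F u| ^ (2 * κ) ≤ S ^ (2 * κ - 2) *
      ∫ u, (F (u + γ * δ) - F u) ^ 2 := by
    rw [← integral_const_mul]
    refine integral_mono_of_nonneg (Eventually.of_forall fun u => by positivity)
      (hsqi.const_mul _) (Eventually.of_forall fun u => ?_)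
    simp only
    have hD : |F (u + γ * δ) - F u| ≤ S := by
      rw [abs_le]; constructor <;> linarith [hF0 u, hF0 (u + γ * δ), hFS u, hFS (u + γ * δ)]
    rcases (abs_nonneg (F (u + γ * δ) - F u)).eq_or_lt with h0 | h0
    · rw [← h0, Real.zero_rpow (by positivity)]; positivity
    · have : |F (u + γ * δ) - F u| ^ (2 * κ)
          = |F (u + γ * δ) - F u| ^ (2 * κ - 2) * |F (u + γ * δ) - F u| ^ 2 := by
        rw [← Real.rpow_natCast, ← Real.rpow_add h0]; congr 1; push_cast; ring
      rw [this, sq_abs]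
      gcongr
      linarith
  have hYp : Y ^ (2 * κ) = Y ^ (2 * κ - 2) * Y ^ 2 := by
    rcases hY0.eq_or_lt with h0 | h0
    · rw [← h0, Real.zero_rpow (by positivity)]; simp
    · rw [← Real.rpow_natCast, ← Real.rpow_add h0]; congr 1; push_cast; ring
  calc γ⁻¹ * ∫ u, |F (u + γ * δ) - F u| ^ (2 * κ)
      ≤ γ⁻¹ * (S ^ (2 * κ - 2) * (10 * Real.pi ^ 2 * K ^ 2 * (γ * δ))) := by
        gcongr
        exact hmain.trans (by gcongr)
    _ = _ := by
        rw [hYp, hS, hK, Real.mul_rpow (by positivity) hY0]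
        field_simp

lemma sin_gap {x0 x : ℝ} (hx0 : 0 < x0) (hx : x0 ≤ x) :
    x * min (1/2) (x0 ^ 2 / (2 * Real.pi ^ 2)) ≤ x - Real.sin x := by
  have hxp : 0 < x := hx0.trans_le hx
  rcases le_total x 2 with h | h
  · have h1 : Real.sin x ≤ x * (1 - x ^ 2 / (2 * Real.pi ^ 2)) := by
      have e : Real.sin x = 2 * Real.sin (x/2) * Real.cos (x/2) := by
        rw [← Real.sin_two_mul]; congr 1; ring
      have hc := Real.cos_le_one_sub_mul_cos_sq (x := x/2) (by
        rw [abs_of_pos (by positivity)]; linarith [Real.pi_gt_three])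
      have hc0 : 0 ≤ Real.cos (x/2) := Real.cos_nonneg_of_mem_Icc
        ⟨by linarith [Real.pi_gt_three], by linarith [Real.pi_gt_three]⟩
      have hsn := Real.sin_le (x := x/2) (by positivity)
      rw [e]
      calc 2 * Real.sin (x/2) * Real.cos (x/2) ≤ 2 * (x/2) * Real.cos (x/2) := by gcongr
        _ ≤ 2 * (x/2) * (1 - 2 / Real.pi ^ 2 * (x/2) ^ 2) := by gcongr
        _ = _ := by field_simp
    have h2 : min (1/2) (x0 ^ 2 / (2 * Real.pi ^ 2)) ≤ x ^ 2 / (2 * Real.pi ^ 2) :=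
      (min_le_right _ _).trans (by gcongr)
    nlinarith
  · have h2 : min (1/2) (x0 ^ 2 / (2 * Real.pi ^ 2)) ≤ 1/2 := min_le_left _ _
    nlinarith [Real.sin_le_one x]

lemma rho_tendsto {W : ℝ → ℝ} (hWm : Measurable W) (hW0 : ∀ t, 0 ≤ W t)
    (hWi : Integrable (fun t => t * W t)) :
    Tendsto (fun w : ℝ => ∫ t, (t - Real.sin (w * t) / w) * W t) (nhdsWithin 0 (Ioi 0)) (nhds 0) := by
  suffices h : Tendsto (fun w : ℝ => ∫ t, (t - Real.sin (w * t) / w) * W t)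
      (nhdsWithin 0 (Ioi 0)) (nhds (∫ t : ℝ, (0:ℝ))) by simpa using h
  refine tendsto_integral_filter_of_dominated_convergence (fun t => 2 * |t * W t|) ?_ ?_ ?_ ?_
  · exact Eventually.of_forall fun w => Measurable.aestronglyMeasurable (by fun_prop)
  · filter_upwards [self_mem_nhdsWithin] with w hw
    refine Eventually.of_forall fun t => ?_
    have hw' : (0:ℝ) < w := hw
    rw [norm_mul, Real.norm_eq_abs, Real.norm_eq_abs, abs_mul, ← mul_assoc]
    gcongr
    have h1 : |Real.sin (w * t) / w| ≤ |t| := by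
      rw [abs_div, abs_of_pos hw', div_le_iff₀ hw']
      refine Real.abs_sin_le_abs.trans ?_
      rw [abs_mul, abs_of_pos hw', mul_comm]
    calc |t - Real.sin (w * t) / w| ≤ |t| + |Real.sin (w * t) / w| := abs_sub _ _
      _ ≤ 2 * |t| := by linarith
  · exact hWi.abs.const_mul 2
  · refine Eventually.of_forall fun t => ?_
    have hd : HasDerivAt (fun w : ℝ => Real.sin (w * t)) t 0 := by
      have := ((hasDerivAt_id (0:ℝ)).mul_const t).sin
      simpa using this
    have h1 : Tendsto (fun w : ℝ => Real.sin (w * t) / w) (nhdsWithin 0 (Ioi 0)) (nhds t) := by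
      have := hd.tendsto_slope_zero_right
      refine this.congr fun w => ?_
      simp [div_eq_inv_mul]
    have := (h1.const_sub t).mul_const (W t)
    simpa using this

open scoped FourierTransform in
lemma low_unif {W : ℝ → ℝ} (hWm : Measurable W) (hW0 : ∀ t, 0 ≤ W t)
    (hWn : ∀ t, t < 0 → W t = 0)
    (hWi : Integrable (fun t => t * W t)) {p s₀ a₀ : ℝ} (hp : 0 < p) (hs : 0 < s₀) (ha₀ : 0 < a₀) :
    ∃ c : ℝ, 0 < c ∧ ∀ (G : ℝ → ℝ) (a : ℝ), Integrable G → (∀ t, 0 ≤ G t) → (∀ t, G t ≤ W t) →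
      (∀ t, t < 0 → G t = 0) → (∀ t, 0 ≤ t → t ≤ s₀ → p ≤ G t) → a₀ ≤ a → a * ∫ t, G t ≤ 1 →
      ∀ ξ : ℝ, c * min 1 |ξ| ≤ ‖1 - a * 𝓕 (fun t => (G t : ℂ)) ξ‖ := by
  have hev := (rho_tendsto hWm hW0 hWi).eventually_lt_const (show 0 < p * s₀ ^ 2 / 4 by positivity)
  obtain ⟨w₀, hw₀, hρ⟩ : ∃ w₀ > 0, ∀ w ∈ Ioc (0:ℝ) w₀,
      ∫ t, (t - Real.sin (w * t) / w) * W t < p * s₀ ^ 2 / 4 := by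
    obtain ⟨u, hu, hu'⟩ := (mem_nhdsGT_iff_exists_Ioc_subset).1 hev
    exact ⟨u, hu, fun w hw => hu' hw⟩
  set c₁ := a₀ * p * s₀ * min (1/2) ((w₀ * s₀) ^ 2 / (2 * Real.pi ^ 2)) with hc₁
  have hc₁p : 0 < c₁ := by
    have := Real.pi_pos
    have : 0 < min (1/2) ((w₀ * s₀) ^ 2 / (2 * Real.pi ^ 2)) := lt_min (by norm_num) (by positivity)
    positivity
  refine ⟨min c₁ (a₀ * (p * s₀ ^ 2 / 4)), lt_min hc₁p (by positivity), ?_⟩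
  intro G a hG hG0 hGW hGn hGp haa haG ξ
  have ha : 0 < a := ha₀.trans_le haa
  rcases eq_or_ne ξ 0 with rfl | hξ
  · simp
  set w := 2 * Real.pi * |ξ| with hw
  have hξp : 0 < |ξ| := abs_pos.2 hξ
  have hwp : 0 < w := by have := Real.pi_pos; positivity
  have hwξ : |ξ| ≤ w := by have := Real.pi_gt_three; rw [hw]; nlinarith
  have hint : Integrable (fun v => Complex.exp (((-2 * Real.pi * v * ξ : ℝ):ℂ) * Complex.I) * (G v : ℂ)) := by
    refine hG.ofReal.bdd_mul (c := 1) (Continuous.aestronglyMeasurable (by fun_prop)) (Eventually.of_forall fun v => ?_)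
    rw [Complex.norm_exp_ofReal_mul_I]
  have hFT : 𝓕 (fun t => (G t : ℂ)) ξ
      = ∫ v, Complex.exp (((-2 * Real.pi * v * ξ : ℝ):ℂ) * Complex.I) * (G v : ℂ) := by
    rw [Real.fourier_real_eq_integral_exp_smul]; simp
  have hre : (𝓕 (fun t => (G t : ℂ)) ξ).re = ∫ t, Real.cos (w * t) * G t := by
    rw [hFT, ← RCLike.re_eq_complex_re, ← integral_re hint]
    congr 1; ext t
    rw [RCLike.re_eq_complex_re, Complex.re_mul_ofReal, Complex.exp_ofReal_mul_I_re]
    congr 1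
    rcases abs_cases ξ with ⟨h, _⟩ | ⟨h, _⟩
    · rw [← Real.cos_neg, hw, h]; congr 1; ring
    · rw [hw, h]; congr 1; ring
  have him : |(𝓕 (fun t => (G t : ℂ)) ξ).im| = |∫ t, Real.sin (w * t) * G t| := by
    have e1 : (𝓕 (fun t => (G t : ℂ)) ξ).im = ∫ t, Real.sin (-2 * Real.pi * t * ξ) * G t := by
      rw [hFT, ← RCLike.im_eq_complex_im, ← integral_im hint]
      congr 1; ext t
      rw [RCLike.im_eq_complex_im, Complex.im_mul_ofReal, Complex.exp_ofReal_mul_I_im]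
    rw [e1]
    rcases abs_cases ξ with ⟨h, _⟩ | ⟨h, _⟩
    · rw [← abs_neg, ← integral_neg]
      congr 2; ext t
      rw [← neg_mul, ← Real.sin_neg, hw, h]; congr 2; ring
    · congr 2; ext t
      rw [hw, h]; congr 2; ring
  have hcosI : Integrable (fun t => Real.cos (w * t) * G t) := by
    refine hG.bdd_mul (c := 1) (Continuous.aestronglyMeasurable (by fun_prop)) (Eventually.of_forall fun v => ?_)
    exact Real.abs_cos_le_one _
  have hsinI : Integrable (fun t => Real.sin (w * t) * G t) := by
    refine hG.bdd_mul (c := 1) (Continuous.aestronglyMeasurable (by fun_prop)) (Eventually.of_forall fun v => ?_)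
    exact Real.abs_sin_le_one _
  rcases le_total w w₀ with hww | hww
  · -- low frequency
    have htG : Integrable (fun t => t * G t) := by
      refine hWi.mono (continuous_id.aestronglyMeasurable.mul hG.aestronglyMeasurable)
        (Eventually.of_forall fun t => ?_)
      rw [norm_mul, norm_mul]
      gcongr
      rw [Real.norm_of_nonneg (hG0 t), Real.norm_of_nonneg (hW0 t)]
      exact hGW t
    have hdiff : ∫ t, (t - Real.sin (w * t) / w) * G t ≤ p * s₀ ^ 2 / 4 := by
      refine le_trans ?_ (hρ w ⟨hwp, hww⟩).le
      have hpos : ∀ t, 0 ≤ t → 0 ≤ t - Real.sin (w * t) / w := by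
        intro t ht
        rw [sub_nonneg, div_le_iff₀ hwp, mul_comm t]
        exact Real.sin_le (by positivity)
      have hsW2 : Integrable (fun t => (t - Real.sin (w * t) / w) * W t) := by
        refine (hWi.abs.const_mul 2).mono' (Measurable.aestronglyMeasurable (by fun_prop))
          (Eventually.of_forall fun t => ?_)
        rw [norm_mul, Real.norm_eq_abs, Real.norm_eq_abs, abs_mul, ← mul_assoc]
        gcongr
        have h1 : |Real.sin (w * t) / w| ≤ |t| := by
          rw [abs_div, abs_of_pos hwp, div_le_iff₀ hwp]
          refine Real.abs_sin_le_abs.trans ?_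
          rw [abs_mul, abs_of_pos hwp, mul_comm]
        calc |t - Real.sin (w * t) / w| ≤ |t| + |Real.sin (w * t) / w| := abs_sub _ _
          _ ≤ 2 * |t| := by linarith
      refine integral_mono ?_ hsW2 fun t => ?_
      · refine (htG.sub (hsinI.const_mul w⁻¹)).congr (Eventually.of_forall fun t => ?_)
        show t * G t - w⁻¹ * (Real.sin (w * t) * G t) = (t - Real.sin (w * t) / w) * G t
        ring
      · rcases lt_or_ge t 0 with h | h
        · simp [hGn t h, hWn t h]
        · exact mul_le_mul_of_nonneg_left (hGW t) (hpos t h)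
    have hsplit : ∫ t, Real.sin (w * t) * G t
        = w * (∫ t, t * G t) - w * ∫ t, (t - Real.sin (w * t) / w) * G t := by
      have e : (fun t => (t - Real.sin (w * t) / w) * G t)
          = fun t => t * G t - w⁻¹ * (Real.sin (w * t) * G t) := by
        ext t; ring
      rw [e, integral_sub htG (hsinI.const_mul _), integral_const_mul]
      field_simp
      ring
    have htlow : p * s₀ ^ 2 / 2 ≤ ∫ t, t * G t := by
      have e1 : p * s₀ ^ 2 / 2 = ∫ t, (Ioc 0 s₀).indicator (fun t => p * t) t := by
        rw [integral_indicator measurableSet_Ioc, ← intervalIntegral.integral_of_le hs.le,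
          intervalIntegral.integral_const_mul, integral_id]
        ring
      rw [e1]
      refine integral_mono ?_ htG fun t => ?_
      · rw [integrable_indicator_iff measurableSet_Ioc]
        exact (Continuous.integrableOn_Icc (by fun_prop)).mono_set Ioc_subset_Icc_self
      · by_cases h : t ∈ Ioc 0 s₀
        · rw [indicator_of_mem h]
          rw [mul_comm]
          exact mul_le_mul_of_nonneg_left (hGp t h.1.le h.2) h.1.le
        · rw [indicator_of_notMem h]
          rcases lt_or_ge t 0 with h' | h'
          · rw [hGn t h']; simp
          · exact mul_nonneg h' (hG0 t)
    have hsin : w * (p * s₀ ^ 2 / 4) ≤ ∫ t, Real.sin (w * t) * G t := by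
      rw [hsplit]; nlinarith
    calc min c₁ (a₀ * (p * s₀ ^ 2 / 4)) * min 1 |ξ| ≤ (a₀ * (p * s₀ ^ 2 / 4)) * w := by
          gcongr
          · exact min_le_right _ _
          · exact (min_le_right _ _).trans hwξ
      _ ≤ a * (w * (p * s₀ ^ 2 / 4)) := by
          rw [mul_assoc, mul_comm _ w]; gcongr
      _ ≤ a * |∫ t, Real.sin (w * t) * G t| := by
          gcongr; exact hsin.trans (le_abs_self _)
      _ = |(1 - a * 𝓕 (fun t => (G t : ℂ)) ξ).im| := by
          rw [← him]; simp [abs_mul, abs_of_pos ha]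
      _ ≤ _ := Complex.abs_im_le_norm _
  · have hlow : p * s₀ * min (1/2) ((w₀ * s₀) ^ 2 / (2 * Real.pi ^ 2))
        ≤ ∫ t, (1 - Real.cos (w * t)) * G t := by
      have e1 : ∫ t, (Ioc 0 s₀).indicator (fun t => p * (1 - Real.cos (w * t))) t
          = p * (s₀ - Real.sin (w * s₀) / w) := by
        rw [integral_indicator measurableSet_Ioc, ← intervalIntegral.integral_of_le hs.le,
          intervalIntegral.integral_const_mul, intervalIntegral.integral_sub (by simp)
          (Continuous.intervalIntegrable (by fun_prop) _ _),
          intervalIntegral.integral_comp_mul_left (fun x => Real.cos x) hwp.ne']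
        simp [div_eq_inv_mul]
      have h2 := sin_gap (x0 := w₀ * s₀) (x := w * s₀) (by positivity) (by gcongr)
      have h3 : p * s₀ * min (1/2) ((w₀ * s₀) ^ 2 / (2 * Real.pi ^ 2))
          ≤ p * (s₀ - Real.sin (w * s₀) / w) := by
        rw [mul_assoc]
        gcongr
        rw [show s₀ - Real.sin (w * s₀) / w = (w * s₀ - Real.sin (w * s₀)) / w by field_simp,
          le_div_iff₀ hwp]
        linarith
      refine h3.trans ?_
      rw [← e1]
      refine integral_mono ?_ ?_ fun t => ?_
      · rw [integrable_indicator_iff measurableSet_Ioc]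
        exact (Continuous.integrableOn_Icc (by fun_prop)).mono_set Ioc_subset_Icc_self
      · refine (hG.sub hcosI).congr (Eventually.of_forall fun t => ?_)
        simp; ring
      · have hcc : 0 ≤ 1 - Real.cos (w * t) := by linarith [Real.cos_le_one (w * t)]
        by_cases h : t ∈ Ioc 0 s₀
        · rw [indicator_of_mem h]
          rw [mul_comm]
          exact mul_le_mul_of_nonneg_left (hGp t h.1.le h.2) hcc
        · rw [indicator_of_notMem h]
          exact mul_nonneg hcc (hG0 t)
    have hsub : ∫ t, (1 - Real.cos (w * t)) * G t = (∫ t, G t) - ∫ t, Real.cos (w * t) * G t := by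
      rw [← integral_sub hG hcosI]; congr 1; ext t; ring
    have hm0 : 0 ≤ p * s₀ * min (1/2) ((w₀ * s₀) ^ 2 / (2 * Real.pi ^ 2)) := by positivity
    calc min c₁ (a₀ * (p * s₀ ^ 2 / 4)) * min 1 |ξ| ≤ c₁ * 1 := by
          gcongr
          · exact min_le_left _ _
          · exact min_le_left _ _
      _ = a₀ * (p * s₀ * min (1/2) ((w₀ * s₀) ^ 2 / (2 * Real.pi ^ 2))) := by rw [hc₁]; ring
      _ ≤ a * (p * s₀ * min (1/2) ((w₀ * s₀) ^ 2 / (2 * Real.pi ^ 2))) := by gcongr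
      _ ≤ a * ∫ t, (1 - Real.cos (w * t)) * G t := by gcongr
      _ ≤ (1 - a * 𝓕 (fun t => (G t : ℂ)) ξ).re := by
          rw [hsub, mul_sub]; simp [hre]; linarith
      _ ≤ _ := Complex.re_le_norm _

lemma tail_anti (ν : Measure ℝ) [IsProbabilityMeasure ν] :
    Antitone (fun t => (ν (Ioi t)).toReal) := by
  intro s t h
  exact ENNReal.toReal_mono (measure_ne_top _ _) (measure_mono (Ioi_subset_Ioi h))

lemma tail_le_one (ν : Measure ℝ) [IsProbabilityMeasure ν] (t : ℝ) : (ν (Ioi t)).toReal ≤ 1 := by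
  have : ν (Ioi t) ≤ 1 := prob_le_one
  exact ENNReal.toReal_le_of_le_ofReal zero_le_one (by simpa using this)

lemma layer (ν : Measure ℝ) [IsProbabilityMeasure ν] (hsupp : ν (Iio 0) = 0) {p : ℝ} (hp : 0 < p)
    (hi : Integrable (fun t => t ^ p) ν) :
    Integrable (hl (fun t => t ^ (p - 1) * (ν (Ioi t)).toReal)) ∧
      p * ∫ t, hl (fun t => t ^ (p - 1) * (ν (Ioi t)).toReal) t = ∫ t, t ^ p ∂ν := by
  have hnn : ∀ᵐ t ∂ν, (0:ℝ) ≤ t := by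
    rw [ae_iff]; simp only [not_le]; exact hsupp
  have key := lintegral_rpow_eq_lintegral_meas_lt_mul ν (f := fun t => t) hnn
    aemeasurable_id hp
  have hfin : ∫⁻ t, ENNReal.ofReal (t ^ p) ∂ν ≠ ⊤ := hi.lintegral_lt_top.ne
  have e : ∫⁻ t in Ioi 0, ν {a : ℝ | t < a} * ENNReal.ofReal (t ^ (p - 1))
      = ∫⁻ t in Ioi 0, ENNReal.ofReal (t ^ (p - 1) * (ν (Ioi t)).toReal) := by
    refine setLIntegral_congr_fun measurableSet_Ioi fun t ht => ?_
    have ht' : (0:ℝ) < t := ht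
    rw [ENNReal.ofReal_mul (by positivity), ENNReal.ofReal_toReal (measure_ne_top _ _), mul_comm]
    rfl
  rw [e] at key
  have hm : Measurable (fun t : ℝ => t ^ (p - 1) * (ν (Ioi t)).toReal) := by
    have := (tail_anti ν).measurable
    fun_prop
  have hn : 0 ≤ᵐ[volume.restrict (Ioi 0)] (fun t : ℝ => t ^ (p - 1) * (ν (Ioi t)).toReal) := by
    filter_upwards [ae_restrict_mem measurableSet_Ioi] with t ht
    have ht' : (0:ℝ) < t := ht
    have : 0 ≤ (ν (Ioi t)).toReal := ENNReal.toReal_nonneg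
    simp only [Pi.zero_apply]
    positivity
  have hfin2 : ∫⁻ t in Ioi 0, ENNReal.ofReal (t ^ (p - 1) * (ν (Ioi t)).toReal) ≠ ⊤ := by
    intro h
    rw [h, ENNReal.mul_top (by simpa using hp)] at key
    exact hfin key
  have hint : IntegrableOn (fun t : ℝ => t ^ (p - 1) * (ν (Ioi t)).toReal) (Ioi 0) :=
    (lintegral_ofReal_ne_top_iff_integrable hm.aestronglyMeasurable hn).1 hfin2
  refine ⟨?_, ?_⟩
  · unfold hl
    rw [integrable_indicator_iff measurableSet_Ici, integrableOn_Ici_iff_integrableOn_Ioi]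
    exact hint
  · unfold hl
    rw [integral_indicator measurableSet_Ici, integral_Ici_eq_integral_Ioi,
      integral_eq_lintegral_of_nonneg_ae hn hm.aestronglyMeasurable,
      integral_eq_lintegral_of_nonneg_ae (by filter_upwards [hnn] with t ht; exact Real.rpow_nonneg ht _)
        hi.aestronglyMeasurable, key, ENNReal.toReal_mul, ENNReal.toReal_ofReal hp.le]

lemma layer1 (ν : Measure ℝ) [IsProbabilityMeasure ν] (hsupp : ν (Iio 0) = 0)
    (hi : Integrable (fun t => t) ν) :
    Integrable (hl (fun t => (ν (Ioi t)).toReal)) ∧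
      ∫ t, hl (fun t => (ν (Ioi t)).toReal) t = ∫ t, t ∂ν := by
  have := layer ν hsupp (p := 1) one_pos (by simpa using hi)
  simpa using this

lemma layer2 (ν : Measure ℝ) [IsProbabilityMeasure ν] (hsupp : ν (Iio 0) = 0)
    (hi : Integrable (fun t => t ^ 2) ν) :
    Integrable (fun t => t * hl (fun t => (ν (Ioi t)).toReal) t) ∧
      ∫ t, t * hl (fun t => (ν (Ioi t)).toReal) t = (1/2) * ∫ t, t ^ 2 ∂ν := by
  have h := layer ν hsupp (p := 2) two_pos (by simpa using hi)
  have e : hl (fun t : ℝ => t ^ ((2:ℝ) - 1) * (ν (Ioi t)).toReal)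
      = fun t => t * hl (fun t => (ν (Ioi t)).toReal) t := by
    ext t
    rcases lt_or_ge t 0 with ht | ht
    · rw [hl_of_neg _ ht, hl_of_neg _ ht]; simp
    · rw [hl_of_nonneg _ ht, hl_of_nonneg _ ht]; norm_num
  rw [e] at h
  refine ⟨h.1, ?_⟩
  have := h.2
  simp only [Real.rpow_two] at this
  linarith

lemma mom2_of_rpow (ν : Measure ℝ) [IsProbabilityMeasure ν] (hsupp : ν (Iio 0) = 0) {α : ℝ}
    (hα : 1 < α) (hi : Integrable (fun t => t ^ (2 * α)) ν) :
    Integrable (fun t => t ^ 2) ν ∧ Integrable (fun t => t) ν := by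
  have hnn : ∀ᵐ t ∂ν, (0:ℝ) ≤ t := by
    rw [ae_iff]; simp only [not_le]; exact hsupp
  have h2 : Integrable (fun t => t ^ 2) ν := by
    refine ((integrable_const (1:ℝ)).add hi).mono' (by fun_prop) ?_
    filter_upwards [hnn] with t ht
    rw [Real.norm_of_nonneg (by positivity)]
    simp only [Pi.add_apply]
    rcases le_total t 1 with h | h
    · have : 0 ≤ t ^ (2 * α) := Real.rpow_nonneg ht _
      nlinarith
    · have : t ^ (2:ℝ) ≤ t ^ (2 * α) := Real.rpow_le_rpow_of_exponent_le h (by linarith)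
      rw [Real.rpow_two] at this
      linarith
  refine ⟨h2, ?_⟩
  refine ((integrable_const (1:ℝ)).add h2).mono' (by fun_prop) ?_
  filter_upwards [hnn] with t ht
  rw [Real.norm_of_nonneg ht]
  simp only [Pi.add_apply]
  nlinarith [sq_nonneg (t-1)]

lemma tail_lower (ν : Measure ℝ) [IsProbabilityMeasure ν]
    (hi : Integrable (fun t => t) ν) (hi2 : Integrable (fun t => t ^ 2) ν) {s L : ℝ} (hs : 0 ≤ s)
    (hL : 0 < L) :
    (∫ t, t ∂ν) ≤ s + L * (ν (Ioi s)).toReal + (∫ t, t ^ 2 ∂ν) / L := by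
  have h1 : ∫ t, (s + L * (Ioi s).indicator (fun _ => (1:ℝ)) t + t ^ 2 / L) ∂ν
      = s + L * (ν (Ioi s)).toReal + (∫ t, t ^ 2 ∂ν) / L := by
    have hI : Integrable ((Ioi s).indicator (fun _ => (1:ℝ))) ν :=
      (integrable_const _).indicator measurableSet_Ioi
    have hA : Integrable (fun t => s + L * (Ioi s).indicator (fun _ => (1:ℝ)) t) ν :=
      (integrable_const _).add (hI.const_mul _)
    rw [integral_add hA (hi2.div_const _),
      integral_add (integrable_const _) (hI.const_mul _), integral_const_mul,
      integral_indicator_const _ measurableSet_Ioi, integral_div]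
    simp [Measure.real]
  rw [← h1]
  have hI : Integrable ((Ioi s).indicator (fun _ => (1:ℝ))) ν :=
    (integrable_const _).indicator measurableSet_Ioi
  refine integral_mono hi (((integrable_const _).add (hI.const_mul _)).add (hi2.div_const _)) fun t => ?_
  show t ≤ s + L * (Ioi s).indicator (fun _ => (1:ℝ)) t + t ^ 2 / L
  by_cases h : t ∈ Ioi s
  · rw [indicator_of_mem h]
    rcases le_total t L with h' | h'
    · have : 0 ≤ t ^ 2 / L := by positivity
      linarith
    · have : t ≤ t ^ 2 / L := by rw [le_div_iff₀ hL]; nlinarith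
      linarith
  · rw [indicator_of_notMem h]
    have : 0 ≤ t ^ 2 / L := by positivity
    have : t ≤ s := not_lt.1 h
    linarith

lemma exp_gap (β x γ : ℝ) (hβ : 0 ≤ β) (hx : 0 ≤ x) (hγ : 0 < γ) :
    0 ≤ β * x - γ * (1 - Real.exp (-(β * x) / γ)) ∧
      β * x - γ * (1 - Real.exp (-(β * x) / γ)) ≤ β * x := by
  constructor
  · have := Real.add_one_le_exp (-(β * x) / γ)
    have h2 := mul_le_mul_of_nonneg_left this hγ.le
    rw [mul_add, mul_div_cancel₀ _ hγ.ne'] at h2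
    linarith
  · have : Real.exp (-(β * x) / γ) ≤ 1 := by
      rw [Real.exp_le_one_iff]
      exact div_nonpos_of_nonpos_of_nonneg (by nlinarith [mul_nonneg hβ hx]) hγ.le
    nlinarith

lemma E_tendsto {W : ℝ → ℝ} (hWm : Measurable W) (hW0 : ∀ t, 0 ≤ W t)
    (hWn : ∀ t, t < 0 → W t = 0)
    (hWi : Integrable (fun t => t * W t)) {β : ℝ} (hβ : 0 ≤ β) {γ : ℕ → ℝ} (hγ : ∀ n, 0 < γ n)
    (hγt : Tendsto γ atTop atTop) :
    Tendsto (fun n => ∫ t, (β * t - γ n * (1 - Real.exp (-(β * t) / γ n))) * W t) atTop (nhds 0) := by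
  suffices h : Tendsto (fun n => ∫ t, (β * t - γ n * (1 - Real.exp (-(β * t) / γ n))) * W t)
      atTop (nhds (∫ t : ℝ, (0:ℝ))) by simpa using h
  refine tendsto_integral_filter_of_dominated_convergence (fun t => β * (t * W t)) ?_ ?_ ?_ ?_
  · exact Eventually.of_forall fun w => Measurable.aestronglyMeasurable (by fun_prop)
  · refine Eventually.of_forall fun n => Eventually.of_forall fun t => ?_
    rcases lt_or_ge t 0 with h | h
    · simp [hWn t h]
    · have := exp_gap β t (γ n) hβ h (hγ n)
      rw [Real.norm_of_nonneg (mul_nonneg this.1 (hW0 t)), ← mul_assoc]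
      exact mul_le_mul_of_nonneg_right this.2 (hW0 t)
  · exact hWi.const_mul β
  · refine Eventually.of_forall fun t => ?_
    have hd : HasDerivAt (fun w : ℝ => Real.exp (w * (-(β * t)))) (-(β * t)) 0 := by
      have := ((hasDerivAt_id (0:ℝ)).mul_const (-(β * t))).exp
      simpa using this
    have h1 := hd.tendsto_slope_zero_right
    have h2 : Tendsto (fun n => (γ n)⁻¹) atTop (nhdsWithin 0 (Ioi 0)) :=
      tendsto_inv_atTop_nhdsGT_zero.comp hγt
    have h3 := (((h1.comp h2).const_add (β * t))).mul_const (W t)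
    rw [add_neg_cancel] at h3
    rw [zero_mul (W t)] at h3
    refine h3.congr fun n => ?_
    simp only [Function.comp, smul_eq_mul, inv_inv, zero_add, zero_mul, Real.exp_zero]
    rw [show (γ n)⁻¹ * -(β * t) = -(β * t) / γ n by ring]
    ring

lemma subcrit (ν : Measure ℝ) [IsProbabilityMeasure ν] (hsupp : ν (Iio 0) = 0)
    (hi : Integrable (fun t => t) ν) (hi2 : Integrable (fun t => t ^ 2) ν)
    {W : ℝ → ℝ} (hWm : Measurable W) (hW0 : ∀ t, 0 ≤ W t)
    (hWn : ∀ t, t < 0 → W t = 0)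
    (hWi : Integrable (fun t => t * W t)) (hTW : ∀ t, hl (fun t => (ν (Ioi t)).toReal) t ≤ W t)
    {β γ : ℝ} (hβ : 0 ≤ β) (hγ : 0 < γ) :
    Integrable (hl (fun t => Real.exp (-(β * t) / γ) * (ν (Ioi t)).toReal)) ∧
    γ * ∫ t, hl (fun t => Real.exp (-(β * t) / γ) * (ν (Ioi t)).toReal) t ≤
      γ * (∫ t, t ∂ν) - (β * ((1/2) * ∫ t, t ^ 2 ∂ν)
        - ∫ t, (β * t - γ * (1 - Real.exp (-(β * t) / γ))) * W t) := by
  obtain ⟨h1, h1'⟩ := layer1 ν hsupp hi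
  obtain ⟨h2, h2'⟩ := layer2 ν hsupp hi2
  set T := hl (fun t => (ν (Ioi t)).toReal) with hT
  set g := hl (fun t => Real.exp (-(β * t) / γ) * (ν (Ioi t)).toReal) with hg
  have hTn : ∀ t, t < 0 → T t = 0 := fun t ht => hl_of_neg _ ht
  have hT0 : ∀ t, 0 ≤ T t := hl_nonneg fun t _ => ENNReal.toReal_nonneg
  have hge : ∀ t, g t = Real.exp (-(β * t) / γ) * T t := by
    intro t
    rcases lt_or_ge t 0 with ht | ht
    · rw [hTn t ht, hg, hl_of_neg _ ht]; simp
    · rw [hg, hT, hl_of_nonneg _ ht, hl_of_nonneg _ ht]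
  have hgm : Measurable g := by
    have := (tail_anti ν).measurable
    exact hl_meas (by fun_prop)
  have hgi : Integrable g := by
    refine h1.mono hgm.aestronglyMeasurable (Eventually.of_forall fun t => ?_)
    rcases lt_or_ge t 0 with ht | ht
    · rw [hge, hTn t ht]; simp
    · rw [hge, norm_mul, Real.norm_of_nonneg (Real.exp_pos _).le]
      refine mul_le_of_le_one_left (norm_nonneg _) ?_
      rw [Real.exp_le_one_iff]
      exact div_nonpos_of_nonpos_of_nonneg (by nlinarith [mul_nonneg hβ ht]) hγ.le
  have hEi : Integrable (fun t => (β * t - γ * (1 - Real.exp (-(β * t) / γ))) * W t) := by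
    refine (hWi.const_mul β).mono' (Measurable.aestronglyMeasurable (by fun_prop))
      (Eventually.of_forall fun t => ?_)
    rcases lt_or_ge t 0 with h | h
    · simp [hWn t h]
    · have := exp_gap β t γ hβ h hγ
      rw [Real.norm_of_nonneg (mul_nonneg this.1 (hW0 t)), ← mul_assoc]
      exact mul_le_mul_of_nonneg_right this.2 (hW0 t)
  refine ⟨hgi, ?_⟩
  have hD : Integrable (fun t => β * (t * T t)
      - (β * t - γ * (1 - Real.exp (-(β * t) / γ))) * W t) := (h2.const_mul β).sub hEi
  rw [← h1', ← h2', ← integral_const_mul, ← integral_const_mul, ← integral_const_mul,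
    ← integral_sub (h2.const_mul β) hEi,
    ← integral_sub (h1.const_mul γ) hD]
  refine integral_mono (hgi.const_mul γ) ((h1.const_mul γ).sub hD) fun t => ?_
  show γ * g t ≤ γ * T t - (β * (t * T t) - (β * t - γ * (1 - Real.exp (-(β * t) / γ))) * W t)
  rcases lt_or_ge t 0 with h | h
  · simp [hge, hTn t h, hWn t h]
  · rw [hge]
    have := mul_le_mul_of_nonneg_left (hTW t) (exp_gap β t γ hβ h hγ).1
    linarith

theorem stmt18
    (β α : ℝ) (hβ : 0 ≤ β) (hα : α ∈ Set.Ioo (1:ℝ) 2)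
    (Λ : ℕ → Measure ℝ) (hΛprob : ∀ n, IsProbabilityMeasure (Λ n))
    (hΛsupp : ∀ n, Λ n (Set.Iio 0) = 0)
    (lam m γ : ℕ → ℝ)
    (hlam_pos : ∀ n, 0 < lam n) (hm_pos : ∀ n, 0 < m n) (hγ_pos : ∀ n, 0 < γ n)
    (hγ_top : Tendsto γ atTop atTop)
    (Λbar : ℕ → ℝ → ℝ) (hΛbar : ∀ n t, Λbar n t = (Λ n (Set.Ioi t)).toReal)
    (Λbarβ : ℕ → ℝ → ℝ)
    (hΛbarβ : ∀ n t, Λbarβ n t = Real.exp (-(β * t) / γ n) * Λbar n t)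
    (ηβ : ℕ → ℝ) (hηβ : ∀ n, ηβ n = ∫ t in Set.Ioi (0:ℝ), Λbarβ n t)
    (lam0 η0 σ0 bm : ℝ) (hlam0 : 0 < lam0) (hη0 : 0 < η0) (hσ0 : 0 < σ0)
    (hbm_pos : 0 < bm + β * σ0 * lam0)
    (hmom1 : ∀ n, Integrable (fun t => t) (Λ n))
    (hmom2 : ∀ n, Integrable (fun t => t ^ 2) (Λ n))
    (hlam_lim : Tendsto lam atTop (nhds lam0))
    (hm_lim : Tendsto m atTop (nhds 1))
    (hmean_lim : Tendsto (fun n => ∫ t, t ∂(Λ n)) atTop (nhds η0))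
    (hsec_lim : Tendsto (fun n => (1/2) * ∫ t, t ^ 2 ∂(Λ n)) atTop (nhds σ0))
    (hγ_lim : Tendsto (fun n => γ n * (1 - lam n * m n * ∫ t, t ∂(Λ n))) atTop (nhds bm))
    (C₀ : ℝ) (hC₀ : 0 < C₀)
    (Λstar : Measure ℝ) (hstar_prob : IsProbabilityMeasure Λstar)
    (hstar_supp : Λstar (Set.Iio 0) = 0)
    (hstar_mom : Integrable (fun t => t ^ (2 * α)) Λstar)
    (hdom : ∀ n, ∀ t : ℝ, 0 ≤ t → Λbar n t ≤ C₀ * (Λstar (Set.Ioi t)).toReal)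
    (Rβ : ℕ → ℝ → ℝ) (hRβ : ∀ n t, Rβ n t = resolventFn (lam n * m n) (Λbarβ n) t)
 :
    ∀ κ : ℝ, 1 ≤ κ → ∃ C : ℝ, 0 < C ∧ ∃ n₀ : ℕ, 1 ≤ n₀ ∧
      ∀ n : ℕ, n₀ ≤ n → ∀ δ : ℝ, 0 ≤ δ → ∀ k : ℕ, 1 ≤ k →
        ∀ y : Fin k → ℝ, (∀ j, 0 ≤ y j) →
          (∫ t : ℝ,
            |(if γ n * (t + δ) < 0 then (0:ℝ)
                else resolventK (lam n) (γ n) β (Rβ n) y (γ n * (t + δ))) -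
              (if γ n * t < 0 then (0:ℝ)
                else resolventK (lam n) (γ n) β (Rβ n) y (γ n * t))| ^ (2 * κ))
            ≤ C * (∑ j, (1 + y j)) ^ (2 * κ) * (δ + δ ^ 2) := by
  intro κ hκ
  have hR : ∀ n, Rβ n = resolventFn (lam n * m n) (Λbarβ n) := fun n => funext (hRβ n)
  have hg : ∀ n, Λbarβ n = fun t => Real.exp (-(β * t) / γ n) * (Λ n (Ioi t)).toReal := by
    intro n; ext t; rw [hΛbarβ, hΛbar]
  obtain ⟨hs2, hs1⟩ := mom2_of_rpow Λstar hstar_supp hα.1 hstar_mom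
  set T := hl (fun t => (Λstar (Ioi t)).toReal) with hT
  have hTm : Measurable T := hl_meas (tail_anti Λstar).measurable
  have hT0 : ∀ t, 0 ≤ T t := hl_nonneg fun t _ => ENNReal.toReal_nonneg
  set W : ℝ → ℝ := fun t => C₀ * T t with hW
  have hWm : Measurable W := hTm.const_mul _
  have hW0 : ∀ t, 0 ≤ W t := fun t => mul_nonneg hC₀.le (hT0 t)
  have hWn : ∀ t, t < 0 → W t = 0 := fun t ht => by simp [hW, hT, hl_of_neg _ ht]
  have hWi : Integrable (fun t => t * W t) := by
    refine ((layer2 Λstar hstar_supp hs2).1.const_mul C₀).congr (Eventually.of_forall fun t => ?_)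
    show C₀ * (t * T t) = t * (C₀ * T t)
    ring
  have hTW : ∀ n t, hl (fun t => (Λ n (Ioi t)).toReal) t ≤ W t := by
    intro n t
    rcases lt_or_ge t 0 with ht | ht
    · rw [hl_of_neg _ ht]; exact hW0 t
    · have := hdom n t ht
      rw [hl_of_nonneg _ ht, ← hΛbar]
      simpa [hW, hT, hl_of_nonneg _ ht] using this
  have hexp1 : ∀ n t, 0 ≤ t → Real.exp (-(β * t) / γ n) ≤ 1 := by
    intro n t ht
    rw [Real.exp_le_one_iff]
    exact div_nonpos_of_nonpos_of_nonneg (by nlinarith [mul_nonneg hβ ht]) (hγ_pos n).le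
  have ha_lim : Tendsto (fun n => lam n * m n) atTop (nhds lam0) := by
    simpa using hlam_lim.mul hm_lim
  -- parameters of the lower bound
  set s₀ := η0 / 8 with hs₀
  set L := 32 * σ0 / η0 with hL
  have hLp : 0 < L := by positivity
  have hs₀p : 0 < s₀ := by positivity
  set p := Real.exp (-(β * s₀)) * (s₀ / L) with hp
  have hpp : 0 < p := by positivity
  obtain ⟨c, hc, hcl⟩ := low_unif hWm hW0 hWn hWi hpp hs₀p (half_pos hlam0)
  have hsub : ∀ᶠ n in atTop, 0 < γ n * (1 - lam n * m n * ∫ t, t ∂(Λ n))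
      + lam n * m n * (β * ((1/2) * ∫ t, t ^ 2 ∂(Λ n))
        - ∫ t, (β * t - γ n * (1 - Real.exp (-(β * t) / γ n))) * W t) := by
    have h := hγ_lim.add (ha_lim.mul ((hsec_lim.const_mul β).sub
      (E_tendsto hWm hW0 hWn hWi hβ hγ_pos hγ_top)))
    exact h.eventually_const_lt (by linarith)
  have hall : ∀ᶠ n in atTop, lam n ≤ 2 * lam0 ∧ lam0 / 2 ≤ lam n * m n ∧ lam n * m n ≤ 2 * lam0 ∧
      1 ≤ γ n ∧ η0 / 2 ≤ (∫ t, t ∂(Λ n)) ∧ (1/2) * (∫ t, t ^ 2 ∂(Λ n)) ≤ 2 * σ0 := by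
    filter_upwards [hlam_lim.eventually_le_const (show lam0 < 2 * lam0 by linarith),
      ha_lim.eventually_const_le (half_lt_self hlam0),
      ha_lim.eventually_le_const (show lam0 < 2 * lam0 by linarith),
      hγ_top.eventually_ge_atTop 1, hmean_lim.eventually_const_le (half_lt_self hη0),
      hsec_lim.eventually_le_const (show σ0 < 2 * σ0 by linarith)] with n h1 h2 h3 h4 h5 h6
    exact ⟨h1, h2, h3, h4, h5, h6⟩
  obtain ⟨N, hN⟩ := eventually_atTop.1 (hsub.and hall)
  set s₁ := 1 / (4 * lam0) with hs₁
  have hs₁p : 0 < s₁ := by positivity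
  refine ⟨10 * Real.pi ^ 2 * ((2 * lam0) * (3 + 2 / s₁)) ^ (2 * κ - 2) * ((2 * lam0) / c) ^ 2,
    by have := Real.pi_pos; positivity, max 1 N, le_max_left _ _, ?_⟩
  intro n hn δ hδ k hk y hy
  obtain ⟨hsubn, hl2, ha1, ha2, hγ1, hηn, hσn⟩ := hN n ((le_max_right _ _).trans hn)
  have hapos : 0 < lam n * m n := mul_pos (hlam_pos n) (hm_pos n)
  obtain ⟨hgi, hgle⟩ := subcrit (Λ n) (hΛsupp n) (hmom1 n) (hmom2 n) hWm hW0 hWn hWi (hTW n) hβ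
    (hγ_pos n)
  rw [← hg n] at hgi hgle
  have hq : lam n * m n * ∫ t, hl (Λbarβ n) t < 1 := by
    have h1 := mul_le_mul_of_nonneg_left hgle hapos.le
    have h2 : 0 < γ n * (1 - lam n * m n * ∫ t, hl (Λbarβ n) t) := by nlinarith
    have := pos_of_mul_pos_right h2 (hγ_pos n).le
    linarith
  have hg0 : ∀ t, 0 ≤ t → 0 ≤ Λbarβ n t := by
    intro t _
    rw [hg]
    exact mul_nonneg (Real.exp_pos _).le ENNReal.toReal_nonneg
  have hgT : ∀ t, 0 ≤ t → Λbarβ n t ≤ (Λ n (Ioi t)).toReal := by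
    intro t ht
    rw [hg]
    exact mul_le_of_le_one_left ENNReal.toReal_nonneg (hexp1 n t ht)
  have hgm : Measurable (Λbarβ n) := by
    have := (tail_anti (Λ n)).measurable
    rw [hg]
    fun_prop
  have htail : s₀ / L ≤ (Λ n (Ioi s₀)).toReal := by
    have h := tail_lower (Λ n) (hmom1 n) (hmom2 n) hs₀p.le hLp
    have h2 : (∫ t, t ^ 2 ∂(Λ n)) / L ≤ s₀ := by
      rw [div_le_iff₀ hLp, show s₀ * L = 4 * σ0 by rw [hs₀, hL]; field_simp; norm_num]
      linarith
    rw [div_le_iff₀ hLp]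
    have : s₀ * 8 = η0 := by rw [hs₀]; ring
    nlinarith
  have hlow := hcl (hl (Λbarβ n)) (lam n * m n) hgi (hl_nonneg hg0) (fun t => by
      refine le_trans ?_ (hTW n t)
      rcases lt_or_ge t 0 with ht | ht
      · rw [hl_of_neg _ ht, hl_of_neg _ ht]
      · rw [hl_of_nonneg _ ht, hl_of_nonneg _ ht]; exact hgT t ht)
    (fun t ht => hl_of_neg _ ht) (fun t ht hts => by
      rw [hl_of_nonneg _ ht, hg, hp]
      refine mul_le_mul (Real.exp_le_exp.2 ?_) (htail.trans (tail_anti (Λ n) hts)) (by positivity)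
        (Real.exp_pos _).le
      rw [neg_div, neg_le_neg_iff]
      calc β * t / γ n ≤ β * t := div_le_self (by positivity) hγ1
        _ ≤ β * s₀ := by gcongr) ha1 hq.le
  have hest := single_est hgm hg0 (fun t ht => (hgT t ht).trans (tail_le_one _ _)) hgi hapos hq
    (hlam_pos n) (hγ_pos n) hβ hc hs₁p (by
      rw [hs₁]
      calc lam n * m n * (1 / (4 * lam0)) ≤ (2 * lam0) * (1 / (4 * lam0)) := by gcongr
        _ ≤ 1 / 2 := by field_simp; norm_num) hlow hκ hδ y hy
  rw [hR n]
  refine hest.trans ?_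
  have hY0 : 0 ≤ ∑ j, (1 + y j) := Finset.sum_nonneg fun j _ => by linarith [hy j]
  have hlp := hlam_pos n
  have hκ2 : 0 ≤ 2 * κ - 2 := by linarith
  have hδ2 : δ ≤ δ + δ ^ 2 := by nlinarith
  gcongr
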